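/- arXiv:1603.04653 — 2 statements merged into one kernel-verified Lean document; each statement's English description precedes it below -/
import Mathlib

section
/- Let λ ∈ (0, 2), let a, c, f ∈ C¹([−1,1]) with a(0) = 0 and (c − a'/2)(x) ≥ γ > 0 on [−1,1], and let 0 < ε ≤ 1. Let u ∈ C³([−1,1]) with u(−1) = u(1) = 0 solve −ε u'' + a u' + c u = f on (−1,1) and satisfy |u^{(i)}(x)| ≤ C_u (1 + (ε^{1/2} + |x|)^{λ−i}) for 0 ≤ i ≤ 3 and x ∈ [−1,1]. Let u_N ∈ V^N be the piecewise linear Galerkin finite element solution on the Liseikin mesh with parameter α satisfying 0 < α ≤ min{λ/2, 1/4}. Then there is a constant C, independent of ε and N, such that the L²(−1,1) error satisfies ‖u − u_N‖ ≤ C N^{−2}. -/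
/-- Liseikin's mesh generating function on `[-1,1]`. -/
noncomputable def liseikinPhi (α ε ξ : ℝ) : ℝ :=
  if 0 ≤ ξ then
    (ε ^ (α/2) + ξ * ((1 + ε ^ ((1:ℝ)/2)) ^ α - ε ^ (α/2))) ^ (1/α) - ε ^ ((1:ℝ)/2)
  else
    ε ^ ((1:ℝ)/2) - (ε ^ (α/2) + (-ξ) * ((1 + ε ^ ((1:ℝ)/2)) ^ α - ε ^ (α/2))) ^ (1/α)

/-- The Liseikin mesh points `x_i = φ(i/N, ε)`, `i = -N, …, N`. -/
noncomputable def liseikinX (α ε : ℝ) (N : ℕ) (i : ℤ) : ℝ :=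
  liseikinPhi α ε ((i : ℝ) / N)

/-- The bilinear form `B_ε(v,w) = ε∫ v'w' + ∫ a v' w + ∫ c v w` over `(-1,1)`,
with derivatives taken pointwise (piecewise for mesh functions; the finitely many
mesh points do not affect the integrals). -/
noncomputable def Beps (ε : ℝ) (a c : ℝ → ℝ) (v w : ℝ → ℝ) : ℝ :=
  ε * (∫ y in (-1:ℝ)..1, deriv v y * deriv w y)
    + (∫ y in (-1:ℝ)..1, a y * deriv v y * w y)
    + (∫ y in (-1:ℝ)..1, c y * v y * w y)

/-- The energy norm `|||v|||_ε = (ε∫ (v')² + ∫ v²)^{1/2}` over `(-1,1)`. -/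
noncomputable def energyNorm (ε : ℝ) (v : ℝ → ℝ) : ℝ :=
  Real.sqrt (ε * (∫ y in (-1:ℝ)..1, (deriv v y)^2) + ∫ y in (-1:ℝ)..1, (v y)^2)

/-- Membership in the piecewise linear space `V^N`: continuous on `[-1,1]`,
vanishing at `±1`, and affine on every mesh interval `[x_{i-1}, x_i]`. -/
def MemVN1 (x : ℤ → ℝ) (N : ℕ) (v : ℝ → ℝ) : Prop :=
  ContinuousOn v (Set.Icc (-1) 1) ∧ v (-1) = 0 ∧ v 1 = 0 ∧
  ∀ i : ℤ, -(N:ℤ) < i → i ≤ N → ∀ y ∈ Set.Icc (x (i-1)) (x i),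
    v y = v (x (i-1)) + (v (x i) - v (x (i-1))) / (x i - x (i-1)) * (y - x (i-1))

section Liseikin

open Set MeasureTheory intervalIntegral

/-- `F` agrees on each open mesh element with a function continuous on the closed element. -/
def PiecewiseContinuous (t : ℕ → ℝ) (M : ℕ) (F : ℝ → ℝ) : Prop :=
  ∀ k < M, ∃ g : ℝ → ℝ, ContinuousOn g (Icc (t k) (t (k + 1))) ∧
    EqOn F g (Ioo (t k) (t (k + 1)))

section Mesh

variable {t : ℕ → ℝ} {M : ℕ}

lemma mesh_le (ht : ∀ k < M, t k < t (k + 1)) {i j : ℕ} (hij : i ≤ j) (hj : j ≤ M) :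
    t i ≤ t j := by
  induction j, hij using Nat.le_induction with
  | base => exact le_rfl
  | succ n _ ih => exact (ih (by omega)).trans (ht n (by omega)).le

lemma mesh_Icc_subset (ht : ∀ k < M, t k < t (k + 1)) {k : ℕ} (hk : k < M) :
    Icc (t k) (t (k + 1)) ⊆ Icc (t 0) (t M) :=
  Icc_subset_Icc (mesh_le ht (Nat.zero_le k) hk.le) (mesh_le ht hk le_rfl)

lemma mesh_Ioo_subset (ht : ∀ k < M, t k < t (k + 1)) {k : ℕ} (hk : k < M) :
    Ioo (t k) (t (k + 1)) ⊆ Ioo (t 0) (t M) :=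
  Ioo_subset_Ioo (mesh_le ht (Nat.zero_le k) hk.le) (mesh_le ht hk le_rfl)

lemma exists_mem_mesh_Ioo {y : ℝ} (hy : y ∈ Ioo (t 0) (t M)) (hyt : y ∉ t '' Iic M) :
    ∃ k < M, y ∈ Ioo (t k) (t (k + 1)) := by
  by_contra! h
  have key : ∀ k, k ≤ M → t k < y := by
    intro k
    induction k with
    | zero => exact fun _ => hy.1
    | succ n ih =>
      intro hn
      by_contra hlt
      have hne : y ≠ t (n + 1) := fun he => hyt ⟨n + 1, hn, he.symm⟩
      exact h n hn ⟨ih (by omega), lt_of_le_of_ne (not_lt.mp hlt) hne⟩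
  exact lt_asymm hy.2 (key M le_rfl)

lemma mesh_countable : (t '' Iic M).Countable := (to_countable (Iic M)).image t

namespace PiecewiseContinuous

variable {F G : ℝ → ℝ}

lemma of_continuousOn (ht : ∀ k < M, t k < t (k + 1)) (hF : ContinuousOn F (Icc (t 0) (t M))) :
    PiecewiseContinuous t M F :=
  fun _ hk => ⟨F, hF.mono (mesh_Icc_subset ht hk), fun _ _ => rfl⟩

lemma add (hF : PiecewiseContinuous t M F) (hG : PiecewiseContinuous t M G) :
    PiecewiseContinuous t M (fun y => F y + G y) := by
  intro k hk
  obtain ⟨f, hf, hFf⟩ := hF k hk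
  obtain ⟨g, hg, hGg⟩ := hG k hk
  exact ⟨fun y => f y + g y, hf.add hg, fun y hy => by simp only [hFf hy, hGg hy]⟩

lemma mul (hF : PiecewiseContinuous t M F) (hG : PiecewiseContinuous t M G) :
    PiecewiseContinuous t M (fun y => F y * G y) := by
  intro k hk
  obtain ⟨f, hf, hFf⟩ := hF k hk
  obtain ⟨g, hg, hGg⟩ := hG k hk
  exact ⟨fun y => f y * g y, hf.mul hg, fun y hy => by simp only [hFf hy, hGg hy]⟩

lemma const (r : ℝ) : PiecewiseContinuous t M (fun _ => r) :=
  fun _ _ => ⟨fun _ => r, continuousOn_const, fun _ _ => rfl⟩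

lemma const_mul (r : ℝ) (hF : PiecewiseContinuous t M F) :
    PiecewiseContinuous t M (fun y => r * F y) :=
  (const r).mul hF

lemma sub (hF : PiecewiseContinuous t M F) (hG : PiecewiseContinuous t M G) :
    PiecewiseContinuous t M (fun y => F y - G y) := by
  simpa [sub_eq_add_neg] using hF.add (hG.const_mul (-1))

lemma pow (hF : PiecewiseContinuous t M F) (n : ℕ) :
    PiecewiseContinuous t M (fun y => F y ^ n) := by
  intro k hk
  obtain ⟨f, hf, hFf⟩ := hF k hk
  exact ⟨fun y => f y ^ n, hf.pow n, fun y hy => by simp only [hFf hy]⟩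

lemma abs (hF : PiecewiseContinuous t M F) : PiecewiseContinuous t M (fun y => |F y|) := by
  intro k hk
  obtain ⟨f, hf, hFf⟩ := hF k hk
  exact ⟨fun y => |f y|, hf.abs, fun y hy => by simp only [hFf hy]⟩

lemma intervalIntegrable_element (ht : ∀ k < M, t k < t (k + 1))
    (hF : PiecewiseContinuous t M F) {k : ℕ} (hk : k < M) :
    IntervalIntegrable F volume (t k) (t (k + 1)) := by
  obtain ⟨f, hf, hFf⟩ := hF k hk
  have h1 : IntervalIntegrable f volume (t k) (t (k + 1)) :=
    ContinuousOn.intervalIntegrable_of_Icc (ht k hk).le hf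
  rw [intervalIntegrable_iff_integrableOn_Ioo_of_le (ht k hk).le] at h1 ⊢
  exact h1.congr_fun (fun y hy => (hFf hy).symm) measurableSet_Ioo

lemma intervalIntegrable (ht : ∀ k < M, t k < t (k + 1))
    (hF : PiecewiseContinuous t M F) : IntervalIntegrable F volume (t 0) (t M) :=
  IntervalIntegrable.trans_iterate fun _ hk => hF.intervalIntegrable_element ht hk

lemma sum_integral (ht : ∀ k < M, t k < t (k + 1)) (hF : PiecewiseContinuous t M F) :
    ∑ k ∈ Finset.range M, ∫ y in t k..t (k + 1), F y = ∫ y in t 0..t M, F y :=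
  sum_integral_adjacent_intervals fun _ hk => hF.intervalIntegrable_element ht hk

lemma integral_deriv_eq_sub {F' : ℝ → ℝ} (ht : ∀ k < M, t k < t (k + 1))
    (hF' : PiecewiseContinuous t M F') (hF : ContinuousOn F (Icc (t 0) (t M)))
    (hd : ∀ k < M, ∀ y ∈ Ioo (t k) (t (k + 1)), HasDerivAt F (F' y) y) :
    ∫ y in t 0..t M, F' y = F (t M) - F (t 0) := by
  refine integral_eq_of_hasDerivAt_off_countable_of_le F F' (mesh_le ht (Nat.zero_le M) le_rfl)
    (mesh_countable (t := t) (M := M)) hF (fun y hy => ?_) (hF'.intervalIntegrable ht)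
  obtain ⟨k, hk, hyk⟩ := exists_mem_mesh_Ioo hy.1 hy.2
  exact hd k hk y hyk

lemma integral_mono (ht : ∀ k < M, t k < t (k + 1)) (hF : PiecewiseContinuous t M F)
    (hG : PiecewiseContinuous t M G)
    (h : ∀ k < M, ∀ y ∈ Ioo (t k) (t (k + 1)), F y ≤ G y) :
    ∫ y in t 0..t M, F y ≤ ∫ y in t 0..t M, G y := by
  rw [← hF.sum_integral ht, ← hG.sum_integral ht]
  refine Finset.sum_le_sum fun k hk => ?_
  rw [Finset.mem_range] at hk
  exact integral_mono_on_of_le_Ioo (ht k hk).le (hF.intervalIntegrable_element ht hk)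
    (hG.intervalIntegrable_element ht hk) (h k hk)

end PiecewiseContinuous

/-- Every function has a continuous piecewise linear interpolant on a mesh. -/
lemma exists_piecewise_linear_interpolant (ht : ∀ k < M, t k < t (k + 1)) (u : ℝ → ℝ) :
    ∃ g : ℝ → ℝ, Continuous g ∧ ∀ k < M, ∀ y ∈ Icc (t k) (t (k + 1)),
      g y = u (t k) + (u (t (k + 1)) - u (t k)) / (t (k + 1) - t k) * (y - t k) := by
  suffices H : ∀ n, n ≤ M → ∃ g : ℝ → ℝ, Continuous g ∧ g (t n) = u (t n) ∧
      ∀ k < n, ∀ y ∈ Icc (t k) (t (k + 1)),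
        g y = u (t k) + (u (t (k + 1)) - u (t k)) / (t (k + 1) - t k) * (y - t k) by
    obtain ⟨g, hg, -, h⟩ := H M le_rfl
    exact ⟨g, hg, h⟩
  intro n
  induction n with
  | zero => exact fun _ => ⟨fun _ => u (t 0), continuous_const, rfl, by simp⟩
  | succ n ih =>
    intro hn
    obtain ⟨g, hg, hgn, hgk⟩ := ih (by omega)
    have hlt := ht n hn
    set m := (u (t (n + 1)) - u (t n)) / (t (n + 1) - t n) with hm
    have hmul : m * (t (n + 1) - t n) = u (t (n + 1)) - u (t n) :=
      div_mul_cancel₀ _ (sub_pos.mpr hlt).ne'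
    refine ⟨fun y => g (min y (t n)) + m * (max y (t n) - t n), by fun_prop, ?_, ?_⟩
    · simp only [min_eq_right hlt.le, max_eq_left hlt.le, hgn]
      linarith
    · intro k hk y hy
      rcases Nat.lt_succ_iff_lt_or_eq.mp hk with hk' | rfl
      · have hyn : y ≤ t n := hy.2.trans (mesh_le ht hk' (by omega))
        simp only [min_eq_left hyn, max_eq_right hyn, hgk k hk' y hy]
        ring
      · simp only [min_eq_right hy.1, max_eq_left hy.1, hgn, ← hm]

end Mesh

section Element

lemma abs_sub_le_of_abs_deriv_le {f f' : ℝ → ℝ} {p q K : ℝ}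
    (hf : ContinuousOn f (Icc p q)) (hd : ∀ y ∈ Ioo p q, HasDerivAt f (f' y) y)
    (hK : ∀ y ∈ Ioo p q, |f' y| ≤ K) {y z : ℝ} (hy : y ∈ Icc p q) (hz : z ∈ Icc p q) :
    |f y - f z| ≤ K * |y - z| := by
  wlog hyz : z ≤ y generalizing y z
  · rw [abs_sub_comm, abs_sub_comm y]
    exact this hz hy (le_of_not_ge hyz)
  rcases hyz.eq_or_lt with rfl | hlt
  · simp
  have hsub : Ioo z y ⊆ Ioo p q := Ioo_subset_Ioo hz.1 hy.2
  obtain ⟨x, hx, hxe⟩ := exists_hasDerivAt_eq_slope f f' hlt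
    (hf.mono (Icc_subset_Icc hz.1 hy.2)) (fun x hx => hd x (hsub hx))
  have h1 : f y - f z = f' x * (y - z) := by
    rw [hxe, div_mul_cancel₀ _ (sub_pos.mpr hlt).ne']
  rw [h1, abs_mul]
  exact mul_le_mul_of_nonneg_right (hK x (hsub hx)) (abs_nonneg _)

/-- A function vanishing at both endpoints is bounded by its second derivative. -/
lemma abs_le_of_abs_deriv_two_le {g g₁ g₂ : ℝ → ℝ} {p q K : ℝ} (hpq : p < q)
    (hg : ContinuousOn g (Icc p q)) (hd : ∀ y ∈ Ioo p q, HasDerivAt g (g₁ y) y)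
    (hd₁ : ∀ y ∈ Ioo p q, HasDerivAt g₁ (g₂ y) y) (hp : g p = 0) (hq : g q = 0)
    (hK : ∀ y ∈ Ioo p q, |g₂ y| ≤ K) {y : ℝ} (hy : y ∈ Icc p q) :
    |g y| ≤ K * (q - p) ^ 2 := by
  obtain ⟨z, hz, hz0⟩ := exists_hasDerivAt_eq_zero hpq hg (hp.trans hq.symm) hd
  have hK0 : 0 ≤ K := (abs_nonneg _).trans (hK z hz)
  have h1 : ∀ x ∈ Ioo p q, |g₁ x| ≤ K * (q - p) := by
    intro x hx
    have h := (convex_Ioo p q).norm_image_sub_le_of_norm_hasDerivWithin_le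
      (fun x hx => (hd₁ x hx).hasDerivWithinAt) hK hz hx
    rw [hz0, sub_zero, Real.norm_eq_abs, Real.norm_eq_abs] at h
    refine h.trans (mul_le_mul_of_nonneg_left ?_ hK0)
    rw [abs_le]
    constructor <;> linarith [hx.1, hx.2, hz.1, hz.2]
  have h2 := abs_sub_le_of_abs_deriv_le hg hd h1 hy (left_mem_Icc.mpr hpq.le)
  rw [hp, sub_zero, abs_of_nonneg (sub_nonneg.mpr hy.1)] at h2
  have : K * (q - p) * (y - p) ≤ K * (q - p) * (q - p) :=
    mul_le_mul_of_nonneg_left (by linarith [hy.2]) (mul_nonneg hK0 (by linarith))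
  calc |g y| ≤ _ := h2
    _ ≤ _ := this
    _ = _ := by ring

/-- The slope of an affine function is controlled by its `L¹` norm. -/
lemma abs_slope_mul_sq_le {w : ℝ → ℝ} {p q s : ℝ} (hpq : p < q)
    (hw : ∀ y ∈ Icc p q, w y = w p + s * (y - p)) :
    |s| * (q - p) ^ 2 ≤ 6 * ∫ y in p..q, |w y| := by
  have hwc : ContinuousOn w (Icc p q) :=
    ContinuousOn.congr (by fun_prop) hw
  have hint : IntervalIntegrable (fun y => |w y|) volume p q :=
    ContinuousOn.intervalIntegrable_of_Icc hpq.le hwc.abs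
  have hint' : IntervalIntegrable (fun y => w y * (2 * y - p - q)) volume p q :=
    ContinuousOn.intervalIntegrable_of_Icc hpq.le (hwc.mul (by fun_prop))
  have hval : ∫ y in p..q, w y * (2 * y - p - q) = s * (q - p) ^ 3 / 6 := by
    have hcongr : ∫ y in p..q, w y * (2 * y - p - q)
        = ∫ y in p..q, (w p + s * (y - p)) * (2 * y - p - q) := by
      refine integral_congr fun y hy => ?_
      rw [uIcc_of_le hpq.le] at hy
      simp only [hw y hy]
    have hd : ∀ y ∈ uIcc p q, HasDerivAt (fun y : ℝ => w p * (y ^ 2 - p * y - q * y)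
        + s * (2 / 3 * y ^ 3 - (3 * p + q) / 2 * y ^ 2 + p * (p + q) * y))
        ((w p + s * (y - p)) * (2 * y - p - q)) y := by
      intro y _
      have h2 := hasDerivAt_pow 2 y
      have h3 := hasDerivAt_pow 3 y
      have h1 := hasDerivAt_id' y
      refine ((((h2.sub (h1.const_mul p)).sub (h1.const_mul q)).const_mul (w p)).add
        ((((h3.const_mul (2 / 3)).sub (h2.const_mul ((3 * p + q) / 2))).add
          (h1.const_mul (p * (p + q)))).const_mul s)).congr_deriv ?_
      push_cast
      ring
    rw [hcongr, integral_eq_sub_of_hasDerivAt hd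
      (Continuous.intervalIntegrable (by fun_prop) _ _)]
    ring
  have hle : |∫ y in p..q, w y * (2 * y - p - q)| ≤ ∫ y in p..q, (q - p) * |w y| := by
    refine (abs_integral_le_integral_abs hpq.le).trans
      (integral_mono_on hpq.le hint'.abs (hint.const_mul _) fun y hy => ?_)
    rw [abs_mul, mul_comm]
    refine mul_le_mul_of_nonneg_right ?_ (abs_nonneg _)
    rw [abs_le]
    constructor <;> linarith [hy.1, hy.2]
  have hh : 0 < q - p := sub_pos.mpr hpq
  rw [hval, intervalIntegral.integral_const_mul, abs_div, abs_mul, abs_of_pos (pow_pos hh 3)] at hle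
  norm_num at hle
  have : (q - p) * (|s| * (q - p) ^ 2) ≤ (q - p) * (6 * ∫ y in p..q, |w y|) := by
    linarith [show |s| * (q - p) ^ 3 = (q - p) * (|s| * (q - p) ^ 2) by ring]
  exact le_of_mul_le_mul_left this hh

end Element

section Stability

/-- On one mesh element the convection error functional nearly cancels against `∫ G`, where
`G = h² a u'' / 12` at the point `m`. -/
lemma abs_integral_element_le {a u u₁ u₂ u₃ G v : ℝ → ℝ} {p q m s A E E₃ D : ℝ} (hpq : p < q)
    (hm : m ∈ Icc p q) (ha : ContinuousOn a (Icc p q)) (hG : ContinuousOn G (Icc p q))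
    (hu : ContinuousOn u (Icc p q)) (hu₂ : ContinuousOn u₂ (Icc p q))
    (hd : ∀ y ∈ Ioo p q, HasDerivAt u (u₁ y) y)
    (hd₁ : ∀ y ∈ Ioo p q, HasDerivAt u₁ (u₂ y) y)
    (hd₂ : ∀ y ∈ Ioo p q, HasDerivAt u₂ (u₃ y) y)
    (hv : ∀ y ∈ Icc p q, v y = v p + s * (y - p)) (hvp : v p = u p) (hvq : v q = u q)
    (hA : ∀ y ∈ Icc p q, |a y - a m| ≤ A * |y - m|)
    (hE : ∀ y ∈ Icc p q, |u y - v y| ≤ E)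
    (hE₃ : ∀ y ∈ Ioo p q, |a m * u₃ y| * (q - p) ^ 2 ≤ E₃)
    (hD : ∀ y ∈ Icc p q, |G y - G m| ≤ D * |y - m|)
    (hGm : G m = (q - p) ^ 2 * (a m * u₂ m) / 12)
    (hA0 : 0 ≤ A) (hD0 : 0 ≤ D) :
    |∫ y in p..q, (a y * (u y - v y) + G y)| ≤ (A * E + E₃ + D) * (q - p) ^ 2 := by
  have hh : 0 < q - p := sub_pos.mpr hpq
  have hvc : ContinuousOn v (Icc p q) := ContinuousOn.congr (by fun_prop) hv
  have hs : s * (q - p) = u q - u p := by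
    have := hv q (right_mem_Icc.mpr hpq.le)
    linarith
  set Q : ℝ → ℝ := fun y => a m * u₂ m * ((y - p) * (y - q) / 2 + (q - p) ^ 2 / 12) with hQ
  have hQint : ∫ y in p..q, Q y = 0 := by
    have hdQ : ∀ y ∈ uIcc p q, HasDerivAt (fun y : ℝ => a m * u₂ m *
        (y ^ 3 / 6 - (p + q) / 4 * y ^ 2 + (p * q / 2 + (q - p) ^ 2 / 12) * y)) (Q y) y := by
      intro y _
      refine (((((hasDerivAt_pow 3 y).div_const 6).sub ((hasDerivAt_pow 2 y).const_mul
        ((p + q) / 4))).add ((hasDerivAt_id' y).const_mul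
          (p * q / 2 + (q - p) ^ 2 / 12))).const_mul (a m * u₂ m)).congr_deriv ?_
      simp only [hQ]
      push_cast
      ring
    rw [integral_eq_sub_of_hasDerivAt hdQ (Continuous.intervalIntegrable (by fun_prop) _ _)]
    ring
  have hz : ∀ y ∈ Icc p q,
      |a m * (u y - v y - u₂ m * ((y - p) * (y - q) / 2))| ≤ E₃ * (q - p) := by
    have key : ∀ y ∈ Icc p q,
        |a m * (u y - (u p + s * (y - p)) - u₂ m * ((y - p) * (y - q) / 2))|
          ≤ E₃ / (q - p) * (q - p) ^ 2 := by
      intro y hy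
      refine abs_le_of_abs_deriv_two_le
        (g := fun y => a m * (u y - (u p + s * (y - p)) - u₂ m * ((y - p) * (y - q) / 2)))
        (g₁ := fun y => a m * (u₁ y - s - u₂ m * (y - (p + q) / 2)))
        (g₂ := fun y => a m * (u₂ y - u₂ m)) hpq (by fun_prop) ?_ ?_ ?_ ?_ ?_ hy
      · intro x hx
        have h1 := hasDerivAt_id' x
        refine (((hd x hx).sub (((h1.sub_const p).const_mul s).const_add (u p))).sub
          ((((h1.sub_const p).mul (h1.sub_const q)).div_const 2).const_mul
            (u₂ m))).const_mul (a m) |>.congr_deriv ?_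
        ring
      · intro x hx
        refine ((((hd₁ x hx).sub_const s).sub
          (((hasDerivAt_id' x).sub_const ((p + q) / 2)).const_mul (u₂ m))).const_mul
            (a m)).congr_deriv ?_
        ring
      · simp
      · simp only [sub_self, mul_zero, zero_div, sub_zero]
        rw [hs]
        ring
      · intro x hx
        have h3 : ∀ y ∈ Ioo p q, |a m * u₃ y| ≤ E₃ / (q - p) ^ 2 := fun y hy => by
          rw [le_div_iff₀ (pow_pos hh 2)]
          exact hE₃ y hy
        have h4 := abs_sub_le_of_abs_deriv_le (f := fun y => a m * u₂ y) (by fun_prop)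
          (fun y hy => (hd₂ y hy).const_mul (a m)) h3 (Ioo_subset_Icc_self hx) hm
        have h5 : |x - m| ≤ q - p := by
          rw [abs_le]
          constructor <;> linarith [hx.1, hx.2, hm.1, hm.2]
        have h6 : 0 ≤ E₃ / (q - p) ^ 2 := (abs_nonneg _).trans (h3 x hx)
        calc |a m * (u₂ x - u₂ m)| = |a m * u₂ x - a m * u₂ m| := by rw [mul_sub]
          _ ≤ E₃ / (q - p) ^ 2 * |x - m| := h4
          _ ≤ E₃ / (q - p) ^ 2 * (q - p) := mul_le_mul_of_nonneg_left h5 h6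
          _ = E₃ / (q - p) := by field_simp
    intro y hy
    have := key y hy
    rw [hv y hy, hvp]
    calc _ ≤ E₃ / (q - p) * (q - p) ^ 2 := this
      _ = E₃ * (q - p) := by field_simp
  have hF : IntervalIntegrable (fun y => a y * (u y - v y) + G y) volume p q :=
    ContinuousOn.intervalIntegrable_of_Icc hpq.le (by fun_prop)
  have hQi : IntervalIntegrable Q volume p q :=
    Continuous.intervalIntegrable (by fun_prop) _ _
  have hsub := intervalIntegral.integral_sub hF hQi
  rw [hQint, sub_zero] at hsub
  rw [← hsub]
  have hb := intervalIntegral.norm_integral_le_of_norm_le_const (a := p) (b := q)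
    (C := (A * E + E₃ + D) * (q - p))
    (f := fun y => a y * (u y - v y) + G y - Q y) (fun y hy => by
      rw [uIoc_of_le hpq.le] at hy
      have hy' : y ∈ Icc p q := Ioc_subset_Icc_self hy
      have h5 : |y - m| ≤ q - p := by
        rw [abs_le]
        constructor <;> linarith [hy'.1, hy'.2, hm.1, hm.2]
      have e : a y * (u y - v y) + G y - Q y = (a y - a m) * (u y - v y)
          + a m * (u y - v y - u₂ m * ((y - p) * (y - q) / 2)) + (G y - G m) := by
        simp only [hQ]
        rw [hGm]
        ring
      have i1 : |(a y - a m) * (u y - v y)| ≤ A * (q - p) * E := by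
        rw [abs_mul]
        exact mul_le_mul ((hA y hy').trans (mul_le_mul_of_nonneg_left h5 hA0)) (hE y hy')
          (abs_nonneg _) (by positivity)
      have i3 : |G y - G m| ≤ D * (q - p) :=
        (hD y hy').trans (mul_le_mul_of_nonneg_left h5 hD0)
      rw [e, Real.norm_eq_abs]
      calc _ ≤ _ := abs_add_three _ _ _
        _ ≤ A * (q - p) * E + E₃ * (q - p) + D * (q - p) := by
          linarith [hz y hy']
        _ = _ := by ring)
  rw [Real.norm_eq_abs, abs_of_pos hh] at hb
  calc _ ≤ _ := hb
    _ = _ := by ring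

variable {t : ℕ → ℝ} {M : ℕ}

lemma hasDerivAt_of_affine {v : ℝ → ℝ} {p q s r : ℝ}
    (hv : ∀ y ∈ Icc p q, v y = r + s * (y - p)) {y : ℝ} (hy : y ∈ Ioo p q) :
    HasDerivAt v s y := by
  have h : HasDerivAt (fun y => r + s * (y - p)) s y := by
    simpa using (((hasDerivAt_id' y).sub_const p).const_mul s).const_add r
  refine h.congr_of_eventuallyEq ?_
  filter_upwards [Icc_mem_nhds hy.1 hy.2] with x hx using hv x hx

lemma piecewiseContinuous_deriv {v : ℝ → ℝ} {s : ℕ → ℝ}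
    (hv : ∀ k < M, ∀ y ∈ Icc (t k) (t (k + 1)), v y = v (t k) + s k * (y - t k)) :
    PiecewiseContinuous t M (deriv v) :=
  fun k hk => ⟨fun _ => s k, continuousOn_const,
    fun _ hy => (hasDerivAt_of_affine (hv k hk) hy).deriv⟩

/-- Stability: the discrete error is controlled by consistency bounds on the interpolation error,
where the auxiliary function `G` compensates the leading part of the convection term. -/
lemma discrete_error_le {a a₁ c f u u₁ u₂ G G₁ uN uI : ℝ → ℝ} {sN sI : ℕ → ℝ}
    {ε γ J K : ℝ} (ht : ∀ k < M, t k < t (k + 1)) (hε : 0 ≤ ε)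
    (ha : ContinuousOn a (Icc (t 0) (t M))) (ha₁ : ContinuousOn a₁ (Icc (t 0) (t M)))
    (hda : ∀ y ∈ Ioo (t 0) (t M), HasDerivAt a (a₁ y) y)
    (hc : ContinuousOn c (Icc (t 0) (t M))) (hf : ContinuousOn f (Icc (t 0) (t M)))
    (hu : ContinuousOn u (Icc (t 0) (t M))) (hu₁ : ContinuousOn u₁ (Icc (t 0) (t M)))
    (hu₂ : ContinuousOn u₂ (Icc (t 0) (t M)))
    (hd : ∀ y ∈ Ioo (t 0) (t M), HasDerivAt u (u₁ y) y)
    (hd₁ : ∀ y ∈ Ioo (t 0) (t M), HasDerivAt u₁ (u₂ y) y)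
    (hode : ∀ y ∈ Ioo (t 0) (t M), -ε * u₂ y + a y * u₁ y + c y * u y = f y)
    (hG : ContinuousOn G (Icc (t 0) (t M))) (hG₁ : PiecewiseContinuous t M G₁)
    (hdG : ∀ k < M, ∀ y ∈ Ioo (t k) (t (k + 1)), HasDerivAt G (G₁ y) y)
    (huN : ContinuousOn uN (Icc (t 0) (t M))) (huI : ContinuousOn uI (Icc (t 0) (t M)))
    (hsN : ∀ k < M, ∀ y ∈ Icc (t k) (t (k + 1)), uN y = uN (t k) + sN k * (y - t k))
    (hsI : ∀ k < M, ∀ y ∈ Icc (t k) (t (k + 1)), uI y = uI (t k) + sI k * (y - t k))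
    (hI : ∀ k ≤ M, uI (t k) = u (t k))
    (h0 : uN (t 0) = uI (t 0)) (h1 : uN (t M) = uI (t M))
    (hcoer : ∀ y ∈ Ioo (t 0) (t M), γ ≤ c y - a₁ y / 2)
    (hgal : ε * (∫ y in t 0..t M, deriv uN y * deriv (fun z => uN z - uI z) y)
      + (∫ y in t 0..t M, a y * deriv uN y * (uN y - uI y))
      + (∫ y in t 0..t M, c y * uN y * (uN y - uI y))
      = ∫ y in t 0..t M, f y * (uN y - uI y))
    (hK : ∀ k < M, ∀ y ∈ Ioo (t k) (t (k + 1)),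
      |a₁ y * (u y - uI y) + G₁ y - c y * (u y - uI y)| ≤ K)
    (hJ : ∀ k < M, |∫ y in t k..t (k + 1), (a y * (u y - uI y) + G y)|
      ≤ J * (t (k + 1) - t k) ^ 2) :
    γ * (∫ y in t 0..t M, (uN y - uI y) ^ 2)
      ≤ (K + 6 * J) * ∫ y in t 0..t M, |uN y - uI y| := by
  set w : ℝ → ℝ := fun y => uN y - uI y with hw
  have hsw : ∀ k < M, ∀ y ∈ Icc (t k) (t (k + 1)),
      w y = w (t k) + (sN k - sI k) * (y - t k) := by
    intro k hk y hy
    simp only [hw]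
    rw [hsN k hk y hy, hsI k hk y hy]
    ring
  have hwc : ContinuousOn w (Icc (t 0) (t M)) := huN.sub huI
  have pw := PiecewiseContinuous.of_continuousOn ht hwc
  have pa := PiecewiseContinuous.of_continuousOn ht ha
  have pa₁ := PiecewiseContinuous.of_continuousOn ht ha₁
  have pc := PiecewiseContinuous.of_continuousOn ht hc
  have pf := PiecewiseContinuous.of_continuousOn ht hf
  have pu := PiecewiseContinuous.of_continuousOn ht hu
  have pu₁ := PiecewiseContinuous.of_continuousOn ht hu₁
  have pu₂ := PiecewiseContinuous.of_continuousOn ht hu₂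
  have pG := PiecewiseContinuous.of_continuousOn ht hG
  have puN := PiecewiseContinuous.of_continuousOn ht huN
  have puI := PiecewiseContinuous.of_continuousOn ht huI
  have pdN := piecewiseContinuous_deriv hsN
  have pdI := piecewiseContinuous_deriv hsI
  have pdw := piecewiseContinuous_deriv hsw
  set dN := deriv uN
  set dI := deriv uI
  set dw := deriv w
  have edN : ∀ k < M, ∀ y ∈ Ioo (t k) (t (k + 1)), dN y = sN k := fun k hk y hy =>
    (hasDerivAt_of_affine (hsN k hk) hy).deriv
  have edI : ∀ k < M, ∀ y ∈ Ioo (t k) (t (k + 1)), dI y = sI k := fun k hk y hy =>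
    (hasDerivAt_of_affine (hsI k hk) hy).deriv
  have edw : ∀ k < M, ∀ y ∈ Ioo (t k) (t (k + 1)), dw y = sN k - sI k := fun k hk y hy =>
    (hasDerivAt_of_affine (hsw k hk) hy).deriv
  set η : ℝ → ℝ := fun y => u y - uI y with hη
  have pη : PiecewiseContinuous t M η := pu.sub puI
  set Z : ℝ → ℝ := fun y => ε * (u₁ y * w y) + 1 / 2 * (a y * w y ^ 2)
    - a y * η y * w y - G y * w y with hZ
  set Z₁ : ℝ → ℝ := fun y => ε * (u₂ y * w y + u₁ y * dw y)
    + 1 / 2 * (a₁ y * w y ^ 2 + 2 * (a y * w y * dw y))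
    - (a₁ y * η y * w y + a y * (u₁ y - dI y) * w y + a y * η y * dw y)
    - (G₁ y * w y + G y * dw y) with hZ₁
  set R : ℝ → ℝ := fun y => (a y * η y + G y - ε * (u₁ y - dI y)) * dw y with hR
  set T : ℝ → ℝ := fun y => ε * (dN y * dw y) + a y * dN y * w y + c y * uN y * w y
    - f y * w y with hT
  have pZ₁ : PiecewiseContinuous t M Z₁ :=
    ((((pu₂.mul pw).add (pu₁.mul pdw)).const_mul ε).add
      (((pa₁.mul (pw.pow 2)).add (((pa.mul pw).mul pdw).const_mul 2)).const_mul (1 / 2))).sub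
      ((((pa₁.mul pη).mul pw).add ((pa.mul (pu₁.sub pdI)).mul pw)).add
        ((pa.mul pη).mul pdw)) |>.sub ((hG₁.mul pw).add (pG.mul pdw))
  have pR : PiecewiseContinuous t M R :=
    (((pa.mul pη).add pG).sub ((pu₁.sub pdI).const_mul ε)).mul pdw
  have pT₁ := (pdN.mul pdw).const_mul ε
  have pT₂ := (pa.mul pdN).mul pw
  have pT₃ := (pc.mul puN).mul pw
  have pT₄ := pf.mul pw
  have pT : PiecewiseContinuous t M T := ((pT₁.add pT₂).add pT₃).sub pT₄
  have hTint : ∫ y in t 0..t M, T y = 0 := by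
    simp only [hT]
    rw [intervalIntegral.integral_sub (((pT₁.add pT₂).add pT₃).intervalIntegrable ht)
        (pT₄.intervalIntegrable ht),
      intervalIntegral.integral_add ((pT₁.add pT₂).intervalIntegrable ht)
        (pT₃.intervalIntegrable ht),
      intervalIntegral.integral_add (pT₁.intervalIntegrable ht) (pT₂.intervalIntegrable ht),
      intervalIntegral.integral_const_mul, hgal, sub_self]
  have hw0 : w (t 0) = 0 := sub_eq_zero.mpr h0
  have hw1 : w (t M) = 0 := sub_eq_zero.mpr h1
  have hZint : ∫ y in t 0..t M, Z₁ y = 0 := by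
    rw [pZ₁.integral_deriv_eq_sub (F := Z) ht (by fun_prop) ?_]
    · simp only [hZ, hw0, hw1]
      ring
    · intro k hk y hy
      have hy' := mesh_Ioo_subset ht hk hy
      have dw' : HasDerivAt w (dw y) y := by
        rw [edw k hk y hy]
        exact hasDerivAt_of_affine (hsw k hk) hy
      have dη : HasDerivAt η (u₁ y - dI y) y := by
        rw [edI k hk y hy]
        exact (hd y hy').sub (hasDerivAt_of_affine (hsI k hk) hy)
      refine ((((((hd₁ y hy').mul dw').const_mul ε).add
        (((hda y hy').mul (dw'.pow 2)).const_mul (1 / 2))).sub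
        (((hda y hy').mul dη).mul dw')).sub ((hdG k hk y hy).mul dw')).congr_deriv ?_
      simp only [hZ₁]
      push_cast
      simp only [Pi.mul_apply, Pi.pow_apply]
      ring
  have hRint : -(6 * J * ∫ y in t 0..t M, |w y|) ≤ ∫ y in t 0..t M, R y := by
    rw [← pR.sum_integral ht, ← pw.abs.sum_integral ht, Finset.mul_sum,
      ← Finset.sum_neg_distrib]
    refine Finset.sum_le_sum fun k hk => ?_
    rw [Finset.mem_range] at hk
    have hlt := ht k hk
    have e1 : ∫ y in t k..t (k + 1), (u₁ y - sI k) = 0 := by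
      have hsub := mesh_Icc_subset ht hk
      have hc : ContinuousOn (fun y => u₁ y - sI k) (Icc (t k) (t (k + 1))) :=
        (hu₁.mono hsub).sub continuousOn_const
      rw [integral_eq_sub_of_hasDerivAt_of_le (f := η) hlt.le
        ((hu.sub huI).mono hsub) (fun y hy => (hd y (mesh_Ioo_subset ht hk hy)).sub
          (hasDerivAt_of_affine (hsI k hk) hy)) (hc.intervalIntegrable_of_Icc hlt.le)]
      simp only [hη, hI k hk.le, hI (k + 1) hk, sub_self]
    have e2 : ∫ y in t k..t (k + 1), R y
        = (sN k - sI k) * ∫ y in t k..t (k + 1), (a y * η y + G y) := by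
      have i1 := ((pa.mul pη).add pG).intervalIntegrable_element ht hk
      have i2 : IntervalIntegrable (fun y => ε * (u₁ y - sI k)) volume (t k) (t (k + 1)) :=
        ((pu₁.sub (PiecewiseContinuous.const (sI k))).const_mul ε).intervalIntegrable_element
          ht hk
      have e3 : ∫ y in t k..t (k + 1), R y = ∫ y in t k..t (k + 1),
          (sN k - sI k) * (a y * η y + G y - ε * (u₁ y - sI k)) := by
        rw [integral_of_le hlt.le, integral_of_le hlt.le, integral_Ioc_eq_integral_Ioo,
          integral_Ioc_eq_integral_Ioo]
        refine setIntegral_congr_fun measurableSet_Ioo fun y hy => ?_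
        simp only [hR, edw k hk y hy, edI k hk y hy]
        ring
      rw [e3, intervalIntegral.integral_const_mul, intervalIntegral.integral_sub i1 i2,
        intervalIntegral.integral_const_mul, e1, mul_zero, sub_zero]
    have hJ0 : 0 ≤ J := by
      have := (abs_nonneg _).trans (hJ k hk)
      exact nonneg_of_mul_nonneg_left this (pow_pos (sub_pos.mpr hlt) 2)
    have h6 := abs_slope_mul_sq_le hlt (hsw k hk)
    have h7 : |∫ y in t k..t (k + 1), R y| ≤ 6 * J * ∫ y in t k..t (k + 1), |w y| := by
      rw [e2, abs_mul]
      calc _ ≤ |sN k - sI k| * (J * (t (k + 1) - t k) ^ 2) :=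
            mul_le_mul_of_nonneg_left (hJ k hk) (abs_nonneg _)
        _ = J * (|sN k - sI k| * (t (k + 1) - t k) ^ 2) := by ring
        _ ≤ J * (6 * ∫ y in t k..t (k + 1), |w y|) := mul_le_mul_of_nonneg_left h6 hJ0
        _ = _ := by ring
    linarith [neg_abs_le (∫ y in t k..t (k + 1), R y)]
  have pL₁ := (pw.pow 2).const_mul γ
  have pL₂ := pw.abs.const_mul K
  have hmono := (((pL₁.sub pL₂).add pZ₁).add pR).integral_mono ht pT (fun k hk y hy => by
    have hy' := mesh_Ioo_subset ht hk hy
    have hww : (γ - (c y - a₁ y / 2)) * w y ^ 2 ≤ 0 :=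
      mul_nonpos_of_nonpos_of_nonneg (by linarith [hcoer y hy']) (sq_nonneg _)
    have hKw : -(K * |w y|) ≤ (a₁ y * η y + G₁ y - c y * η y) * w y := by
      have : |(a₁ y * η y + G₁ y - c y * η y) * w y| ≤ K * |w y| := by
        rw [abs_mul]
        exact mul_le_mul_of_nonneg_right (hK k hk y hy) (abs_nonneg _)
      linarith [neg_abs_le ((a₁ y * η y + G₁ y - c y * η y) * w y)]
    have hs : 0 ≤ ε * (sN k - sI k) ^ 2 := mul_nonneg hε (sq_nonneg _)
    have e : T y = ε * (sN k - sI k) ^ 2 + (c y - a₁ y / 2) * w y ^ 2 + Z₁ y + R y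
        + (a₁ y * η y + G₁ y - c y * η y) * w y := by
      simp only [hT, hZ₁, hR, hη, ← hode y hy', edN k hk y hy, edI k hk y hy, edw k hk y hy]
      simp only [hw]
      ring
    rw [e]
    linarith)
  rw [hTint, intervalIntegral.integral_add (((pL₁.sub pL₂).add pZ₁).intervalIntegrable ht)
      (pR.intervalIntegrable ht),
    intervalIntegral.integral_add ((pL₁.sub pL₂).intervalIntegrable ht)
      (pZ₁.intervalIntegrable ht),
    intervalIntegral.integral_sub (pL₁.intervalIntegrable ht) (pL₂.intervalIntegrable ht),
    hZint, intervalIntegral.integral_const_mul, intervalIntegral.integral_const_mul] at hmono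
  linarith

lemma integral_sq_le_of_le_integral_abs {w : ℝ → ℝ} {p q γ K : ℝ} (hpq : p ≤ q) (hγ : 0 < γ)
    (hw : ContinuousOn w (Icc p q))
    (h : γ * (∫ y in p..q, w y ^ 2) ≤ K * ∫ y in p..q, |w y|) :
    ∫ y in p..q, w y ^ 2 ≤ (q - p) * K ^ 2 / γ ^ 2 := by
  have i2 : IntervalIntegrable (fun y => w y ^ 2) volume p q :=
    (hw.pow 2).intervalIntegrable_of_Icc hpq
  have i1 : IntervalIntegrable (fun y => |w y|) volume p q :=
    hw.abs.intervalIntegrable_of_Icc hpq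
  have hm : ∫ y in p..q, K * |w y| ≤ ∫ y in p..q, (γ / 2 * w y ^ 2 + K ^ 2 / (2 * γ)) := by
    refine integral_mono_on hpq (i1.const_mul K)
      ((i2.const_mul (γ / 2)).add intervalIntegrable_const) fun y _ => ?_
    have : 0 ≤ (γ * |w y| - K) ^ 2 / (2 * γ) := by positivity
    have e : (γ * |w y| - K) ^ 2 / (2 * γ)
        = γ / 2 * w y ^ 2 + K ^ 2 / (2 * γ) - K * |w y| := by
      rw [← sq_abs (w y)]
      field_simp
      ring
    linarith
  rw [intervalIntegral.integral_add (i2.const_mul (γ / 2)) intervalIntegrable_const,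
    intervalIntegral.integral_const_mul, intervalIntegral.integral_const_mul,
    intervalIntegral.integral_const, smul_eq_mul] at hm
  have h3 : γ / 2 * (∫ y in p..q, w y ^ 2) ≤ (q - p) * (K ^ 2 / (2 * γ)) := by linarith
  have e : (q - p) * K ^ 2 / γ ^ 2 = (q - p) * (K ^ 2 / (2 * γ)) / (γ / 2) := by
    field_simp
  rw [e, le_div_iff₀ (by positivity)]
  linarith

end Stability

section Weights

lemma rpow_le_eight {s e : ℝ} (hs : 0 < s) (hs2 : s ≤ 2) (he : 0 ≤ e) (he3 : e ≤ 3) :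
    s ^ e ≤ 8 := by
  calc s ^ e ≤ 2 ^ e := Real.rpow_le_rpow hs.le hs2 he
    _ ≤ 2 ^ (3 : ℝ) := Real.rpow_le_rpow_of_exponent_le (by norm_num) he3
    _ = 8 := by norm_num

lemma rpow_mul_abs_le {s lam α Cu j x : ℝ} (hs : 0 < s) (hs2 : s ≤ 2) (hCu : 0 ≤ Cu)
    (hα : α ≤ lam / 2) (hα0 : 0 ≤ α) (hlam : lam ≤ 2) (hj : 2 * α ≤ j) (hj3 : j ≤ 3)
    (hx : |x| ≤ Cu * (1 + s ^ (lam - j))) :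
    s ^ (j - 2 * α) * |x| ≤ 16 * Cu := by
  have h1 : s ^ (j - 2 * α) ≤ 8 := rpow_le_eight hs hs2 (by linarith) (by linarith)
  have h2 : s ^ (lam - 2 * α) ≤ 8 := rpow_le_eight hs hs2 (by linarith) (by linarith)
  have e : s ^ (j - 2 * α) * s ^ (lam - j) = s ^ (lam - 2 * α) := by
    rw [← Real.rpow_add hs]
    ring_nf
  calc s ^ (j - 2 * α) * |x| ≤ s ^ (j - 2 * α) * (Cu * (1 + s ^ (lam - j))) :=
        mul_le_mul_of_nonneg_left hx (Real.rpow_nonneg hs.le _)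
    _ = Cu * (s ^ (j - 2 * α) + s ^ (j - 2 * α) * s ^ (lam - j)) := by ring
    _ ≤ Cu * (8 + 8) := by
        rw [e]
        exact mul_le_mul_of_nonneg_left (by linarith) hCu
    _ = 16 * Cu := by ring

lemma rpow_sub_mul_le_of_le_mul {x y κ j α : ℝ} (hx : 0 < x) (hy : 0 < y) (hκ : 1 ≤ κ)
    (hxy : x ≤ κ * y) (hα : 0 ≤ α) (hj : 2 * α ≤ j) :
    x ^ (j - 2 * α) ≤ κ ^ j * y ^ (j - 2 * α) := by
  have hκ0 : 0 < κ := by linarith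
  calc x ^ (j - 2 * α) ≤ (κ * y) ^ (j - 2 * α) :=
        Real.rpow_le_rpow hx.le hxy (by linarith)
    _ = κ ^ (j - 2 * α) * y ^ (j - 2 * α) := Real.mul_rpow hκ0.le hy.le
    _ ≤ _ := mul_le_mul_of_nonneg_right
        (Real.rpow_le_rpow_of_exponent_le hκ (by linarith)) (Real.rpow_nonneg hy.le _)

end Weights

/-- A mesh on `[-1, 1]` whose element widths follow the weight `(δ + |x|) ^ (1 - α)`, with `0` as a
node; `r` measures the reciprocal of the number of elements. -/
structure IsLayerMesh (t : ℕ → ℝ) (M : ℕ) (α δ κ H r : ℝ) : Prop where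
  left : t 0 = -1
  right : t M = 1
  lt : ∀ k < M, t k < t (k + 1)
  sign : ∀ k < M, 0 ≤ t k ∨ t (k + 1) ≤ 0
  width : ∀ k < M, ∃ m ∈ Icc (t k) (t (k + 1)), t (k + 1) - t k = H * (δ + |m|) ^ (1 - α)
  width_pos : 0 < H
  width_le : H ≤ 2 / α * r
  comparable : ∀ k < M,
    (∀ y ∈ Icc (t k) (t (k + 1)), ∀ z ∈ Icc (t k) (t (k + 1)), δ + |y| ≤ κ * (δ + |z|)) ∨
    ((t k = 0 ∨ t (k + 1) = 0) ∧ ∀ y ∈ Icc (t k) (t (k + 1)), (δ + |y|) ^ α ≤ 4 * r)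

namespace IsLayerMesh

variable {t : ℕ → ℝ} {M : ℕ} {α δ κ H r lam Cu La : ℝ} {u u₁ u₂ u₃ uI a a₁ : ℝ → ℝ}

lemma Icc_subset (h : IsLayerMesh t M α δ κ H r) {k : ℕ} (hk : k < M) :
    Icc (t k) (t (k + 1)) ⊆ Icc (-1) 1 := by
  rw [← h.left, ← h.right]
  exact mesh_Icc_subset h.lt hk

lemma Ioo_subset (h : IsLayerMesh t M α δ κ H r) {k : ℕ} (hk : k < M) :
    Ioo (t k) (t (k + 1)) ⊆ Ioo (-1) 1 := by
  rw [← h.left, ← h.right]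
  exact mesh_Ioo_subset h.lt hk

lemma ne_zero (h : IsLayerMesh t M α δ κ H r) {k : ℕ} (hk : k < M) {y : ℝ}
    (hy : y ∈ Ioo (t k) (t (k + 1))) : y ≠ 0 := by
  rcases h.sign k hk with h0 | h0
  · exact (h0.trans_lt hy.1).ne'
  · exact (hy.2.trans_le h0).ne

lemma width_sq_le (h : IsLayerMesh t M α δ κ H r) : H ^ 2 ≤ (2 / α) ^ 2 * r ^ 2 := by
  rw [← mul_pow]
  exact pow_le_pow_left₀ h.width_pos.le h.width_le 2

lemma sq_width_eq (hδ : 0 < δ) {h m : ℝ} (hm : h = H * (δ + |m|) ^ (1 - α)) :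
    h ^ 2 = H ^ 2 * (δ + |m|) ^ (2 - 2 * α) := by
  have : 0 < δ + |m| := by positivity
  rw [hm, mul_pow, ← Real.rpow_natCast (_ ^ (1 - α)) 2, ← Real.rpow_mul this.le]
  push_cast
  ring_nf

lemma weight_le_two (hδ1 : δ ≤ 1) {y : ℝ} (hy : y ∈ Icc (-1 : ℝ) 1) : δ + |y| ≤ 2 := by
  have : |y| ≤ 1 := abs_le.mpr hy
  linarith

/-- Change of `u` over an interval not containing `0` in terms of the antiderivative of its
derivative bound. -/
lemma abs_sub_le_weight (hδ : 0 < δ) (hlam : 0 < lam) {p q B : ℝ}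
    (hu : ContinuousOn u (Icc p q)) (hd : ∀ y ∈ Ioo p q, HasDerivAt u (u₁ y) y)
    (h0 : ∀ y ∈ Ioo p q, y ≠ 0)
    (hb : ∀ y ∈ Ioo p q, |u₁ y| ≤ Cu * (1 + (δ + |y|) ^ (lam - 1)))
    (hB : ∀ y ∈ Icc p q, (δ + |y|) + (δ + |y|) ^ lam / lam ≤ B) (hCu : 0 ≤ Cu)
    {y z : ℝ} (hy : y ∈ Icc p q) (hz : z ∈ Icc p q) :
    |u y - u z| ≤ Cu * B := by
  wlog hyz : z ≤ y generalizing y z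
  · rw [abs_sub_comm]
    exact this hz hy (le_of_not_ge hyz)
  have hpos : ∀ x : ℝ, 0 < δ + |x| := fun x => by positivity
  have hBpos : ∀ x ∈ Icc p q, 0 ≤ (δ + |x|) + (δ + |x|) ^ lam / lam := fun x _ => by
    have := hpos x
    positivity
  rcases hyz.eq_or_lt with rfl | hlt
  · simp only [sub_self, abs_zero]
    exact mul_nonneg hCu ((hBpos z hz).trans (hB z hz))
  have hsub : Ioo z y ⊆ Ioo p q := Ioo_subset_Ioo hz.1 hy.2
  set g : ℝ → ℝ := fun x => (δ + |x|) + (δ + |x|) ^ lam / lam with hg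
  have hgc : ContinuousOn g (Icc z y) := by
    have h1 : Continuous fun x : ℝ => (δ + |x|) ^ lam :=
      (by fun_prop : Continuous fun x : ℝ => δ + |x|).rpow_const fun x => Or.inl (hpos x).ne'
    exact (by fun_prop : Continuous g).continuousOn
  have hgd : ∀ x ∈ Ioo z y,
      HasDerivAt g ((SignType.sign x : ℝ) * (1 + (δ + |x|) ^ (lam - 1))) x := by
    intro x hx
    have h1 := (hasDerivAt_abs (h0 x (hsub hx))).const_add δ
    refine (h1.add ((h1.rpow_const (p := lam) (Or.inl (hpos x).ne')).div_const lam)).congr_deriv ?_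
    field_simp
  obtain ⟨x, hx, hxe⟩ := exists_ratio_hasDerivAt_eq_ratio_slope u u₁ hlt
    (hu.mono (Icc_subset_Icc hz.1 hy.2)) (fun x hx => hd x (hsub hx)) g _ hgc hgd
  have hx0 := h0 x (hsub hx)
  have hW : 0 < 1 + (δ + |x|) ^ (lam - 1) := by
    have := Real.rpow_pos_of_pos (hpos x) (lam - 1)
    linarith
  have hsgn : |(SignType.sign x : ℝ)| = 1 := by
    rcases lt_or_gt_of_ne hx0 with h | h <;> simp [h]
  have habs := congrArg abs hxe
  rw [abs_mul, abs_mul, abs_mul, hsgn, one_mul, abs_of_pos hW] at habs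
  have hgB : |g y - g z| ≤ B := by
    rw [abs_le]
    constructor <;> linarith [hB y hy, hB z hz, hBpos y hy, hBpos z hz]
  have : |u y - u z| * (1 + (δ + |x|) ^ (lam - 1)) ≤ Cu * B * (1 + (δ + |x|) ^ (lam - 1)) := by
    calc _ = |g y - g z| * |u₁ x| := habs.symm ▸ rfl
      _ ≤ B * (Cu * (1 + (δ + |x|) ^ (lam - 1))) :=
        mul_le_mul hgB (hb x (hsub hx)) (abs_nonneg _) ((abs_nonneg _).trans hgB)
      _ = _ := by ring
  exact le_of_mul_le_mul_right this hW

/-- Pointwise interpolation error on the mesh. -/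
lemma abs_interpolation_error_le (h : IsLayerMesh t M α δ κ H r) (hδ : 0 < δ) (hδ1 : δ ≤ 1)
    (hκ : 1 ≤ κ) (hlam0 : 0 < lam) (hlam : lam ≤ 2) (hα0 : 0 < α) (hα4 : α ≤ 1 / 4)
    (hαl : α ≤ lam / 2) (hCu : 0 ≤ Cu)
    (hu : ContinuousOn u (Icc (-1) 1))
    (hd : ∀ y ∈ Ioo (-1 : ℝ) 1, HasDerivAt u (u₁ y) y)
    (hd₁ : ∀ y ∈ Ioo (-1 : ℝ) 1, HasDerivAt u₁ (u₂ y) y)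
    (hb₁ : ∀ y ∈ Icc (-1 : ℝ) 1, |u₁ y| ≤ Cu * (1 + (δ + |y|) ^ (lam - 1)))
    (hb₂ : ∀ y ∈ Icc (-1 : ℝ) 1, |u₂ y| ≤ Cu * (1 + (δ + |y|) ^ (lam - 2)))
    {k : ℕ} (hk : k < M) {s : ℝ}
    (hs : ∀ y ∈ Icc (t k) (t (k + 1)), uI y = uI (t k) + s * (y - t k))
    (hp : uI (t k) = u (t k)) (hq : uI (t (k + 1)) = u (t (k + 1)))
    {y : ℝ} (hy : y ∈ Icc (t k) (t (k + 1))) :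
    |u y - uI y| ≤ (16 * (2 / α) ^ 2 * κ ^ 2 * Cu + 256 * Cu * (1 + 1 / lam)) * r ^ 2 := by
  have hlt := h.lt k hk
  have hI := h.Icc_subset hk
  have hO := h.Ioo_subset hk
  have hpos : ∀ x : ℝ, 0 < δ + |x| := fun x => by positivity
  have hslope : s * (t (k + 1) - t k) = u (t (k + 1)) - u (t k) := by
    have := hs _ (right_mem_Icc.mpr hlt.le)
    linarith
  have n1 : 0 ≤ 16 * (2 / α) ^ 2 * κ ^ 2 * Cu * r ^ 2 := by positivity
  have n2 : 0 ≤ 256 * Cu * (1 + 1 / lam) * r ^ 2 := by positivity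
  rcases h.comparable k hk with hcomp | ⟨-, hsmall⟩
  · obtain ⟨m, hm, hwidth⟩ := h.width k hk
    have hsq := sq_width_eq hδ hwidth
    have hh : 0 < t (k + 1) - t k := sub_pos.mpr hlt
    have hK : ∀ z ∈ Ioo (t k) (t (k + 1)), |u₂ z| ≤
        16 * (2 / α) ^ 2 * κ ^ 2 * Cu * r ^ 2 / (t (k + 1) - t k) ^ 2 := by
      intro z hz
      have hz' := Ioo_subset_Icc_self hz
      rw [le_div_iff₀ (pow_pos hh 2), hsq]
      have i1 := rpow_sub_mul_le_of_le_mul (j := 2) (hpos m) (hpos z) hκ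
        (hcomp m hm z hz') hα0.le (by linarith)
      have i2 := rpow_mul_abs_le (j := 2) (hpos z) (weight_le_two hδ1 (hI hz')) hCu hαl hα0.le
        hlam (by linarith) (by norm_num) (hb₂ z (hI hz'))
      rw [Real.rpow_two] at i1
      calc |u₂ z| * (H ^ 2 * (δ + |m|) ^ (2 - 2 * α))
          ≤ |u₂ z| * ((2 / α) ^ 2 * r ^ 2 * (κ ^ 2 * (δ + |z|) ^ (2 - 2 * α))) := by
            gcongr
            exact h.width_sq_le
        _ = (2 / α) ^ 2 * r ^ 2 * κ ^ 2 * ((δ + |z|) ^ (2 - 2 * α) * |u₂ z|) := by ring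
        _ ≤ (2 / α) ^ 2 * r ^ 2 * κ ^ 2 * (16 * Cu) :=
            mul_le_mul_of_nonneg_left i2 (by positivity)
        _ = _ := by ring
    have key := abs_le_of_abs_deriv_two_le
      (g := fun y => u y - (u (t k) + s * (y - t k))) (g₁ := fun y => u₁ y - s) hlt
      ((hu.mono hI).sub (by fun_prop))
      (fun x hx => ((hd x (hO hx)).sub ((((hasDerivAt_id' x).sub_const (t k)).const_mul
        s).const_add (u (t k)))).congr_deriv (by ring))
      (fun x hx => (hd₁ x (hO hx)).sub_const s) (by simp) (by simp only [hslope]; ring) hK hy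
    rw [div_mul_cancel₀ _ (pow_pos hh 2).ne'] at key
    rw [hs y hy, hp]
    linarith
  · have hB : ∀ z ∈ Icc (t k) (t (k + 1)),
        (δ + |z|) + (δ + |z|) ^ lam / lam ≤ 128 * (1 + 1 / lam) * r ^ 2 := by
      intro z hz
      have hs2 := weight_le_two hδ1 (hI hz)
      have hsz := hpos z
      have i0 : (δ + |z|) ^ (2 * α) ≤ 16 * r ^ 2 := by
        have e : (δ + |z|) ^ (2 * α) = ((δ + |z|) ^ α) ^ 2 := by
          rw [← Real.rpow_natCast _ 2, ← Real.rpow_mul hsz.le]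
          push_cast
          ring_nf
        rw [e]
        calc _ ≤ (4 * r) ^ 2 := pow_le_pow_left₀ (Real.rpow_nonneg hsz.le _) (hsmall z hz) 2
          _ = _ := by ring
      have gen : ∀ e : ℝ, 2 * α ≤ e → e ≤ 2 → (δ + |z|) ^ e ≤ 128 * r ^ 2 := by
        intro e he he2
        have e1 : (δ + |z|) ^ e = (δ + |z|) ^ (2 * α) * (δ + |z|) ^ (e - 2 * α) := by
          rw [← Real.rpow_add hsz]
          ring_nf
        rw [e1]
        calc _ ≤ 16 * r ^ 2 * 8 := mul_le_mul i0
              (rpow_le_eight hsz hs2 (by linarith) (by linarith))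
              (Real.rpow_nonneg hsz.le _) (by positivity)
          _ = _ := by ring
      have g1 := gen 1 (by linarith) (by norm_num)
      have g2 := gen lam (by linarith) hlam
      rw [Real.rpow_one] at g1
      have g3 : (δ + |z|) ^ lam / lam ≤ 128 * r ^ 2 / lam :=
        div_le_div_of_nonneg_right g2 hlam0.le
      calc _ ≤ 128 * r ^ 2 + 128 * r ^ 2 / lam := add_le_add g1 g3
        _ = _ := by ring
    have hdiff : ∀ z ∈ Icc (t k) (t (k + 1)),
        |u z - u (t k)| ≤ Cu * (128 * (1 + 1 / lam) * r ^ 2) := fun z hz =>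
      abs_sub_le_weight hδ hlam0 (hu.mono hI) (fun x hx => hd x (hO hx))
        (fun x hx => h.ne_zero hk hx)
        (fun x hx => hb₁ x (hI (Ioo_subset_Icc_self hx))) hB hCu hz (left_mem_Icc.mpr hlt.le)
    have d1 := hdiff y hy
    have d2 := hdiff _ (right_mem_Icc.mpr hlt.le)
    have d3 : |s * (y - t k)| ≤ |u (t (k + 1)) - u (t k)| := by
      rw [← hslope, abs_mul, abs_mul]
      refine mul_le_mul_of_nonneg_left ?_ (abs_nonneg s)
      rw [abs_of_nonneg (sub_nonneg.mpr hy.1), abs_of_pos (sub_pos.mpr hlt)]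
      linarith [hy.2]
    have d4 : |u y - uI y| ≤ |u y - u (t k)| + |s * (y - t k)| := by
      rw [hs y hy, hp, show u y - (u (t k) + s * (y - t k))
        = (u y - u (t k)) - s * (y - t k) by ring]
      exact abs_sub _ _
    linarith

end IsLayerMesh

section Compensator

/-- The compensator `h² a u'' / 12` with the squared width replaced by its continuous model. -/
noncomputable def compensator (H α δ : ℝ) (a u₂ : ℝ → ℝ) (y : ℝ) : ℝ :=
  H ^ 2 / 12 * ((δ + |y|) ^ (2 - 2 * α) * (a y * u₂ y))

/-- The derivative of `compensator` away from `0`. -/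
noncomputable def compensatorDeriv (H α δ : ℝ) (a a₁ u₂ u₃ : ℝ → ℝ) (y : ℝ) : ℝ :=
  H ^ 2 / 12 * ((2 - 2 * α) * (SignType.sign y : ℝ) * (δ + |y|) ^ (1 - 2 * α) * (a y * u₂ y)
    + (δ + |y|) ^ (2 - 2 * α) * (a₁ y * u₂ y + a y * u₃ y))

variable {H α δ : ℝ} {a a₁ u₂ u₃ : ℝ → ℝ}

lemma continuous_weight_rpow (hδ : 0 < δ) (e : ℝ) : Continuous fun y : ℝ => (δ + |y|) ^ e :=
  (by fun_prop : Continuous fun y : ℝ => δ + |y|).rpow_const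
    fun y => Or.inl (by positivity : (0 : ℝ) < δ + |y|).ne'

lemma continuousOn_compensator (hδ : 0 < δ) {s : Set ℝ} (ha : ContinuousOn a s)
    (hu₂ : ContinuousOn u₂ s) : ContinuousOn (compensator H α δ a u₂) s :=
  continuousOn_const.mul ((continuous_weight_rpow hδ _).continuousOn.mul (ha.mul hu₂))

lemma hasDerivAt_compensator (hδ : 0 < δ) {y : ℝ} (hy : y ≠ 0)
    (hda : HasDerivAt a (a₁ y) y) (hd₂ : HasDerivAt u₂ (u₃ y) y) :
    HasDerivAt (compensator H α δ a u₂) (compensatorDeriv H α δ a a₁ u₂ u₃ y) y := by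
  have h1 := ((hasDerivAt_abs hy).const_add δ).rpow_const (p := 2 - 2 * α)
    (Or.inl (by positivity : (0 : ℝ) < δ + |y|).ne')
  rw [show 2 - 2 * α - 1 = 1 - 2 * α by ring] at h1
  refine ((h1.mul (hda.mul hd₂)).const_mul (H ^ 2 / 12)).congr_deriv ?_
  simp only [compensatorDeriv, Pi.mul_apply]
  ring

lemma piecewiseContinuous_compensatorDeriv {t : ℕ → ℝ} {M : ℕ} (hδ : 0 < δ)
    (ht : ∀ k < M, t k < t (k + 1)) (hsign : ∀ k < M, 0 ≤ t k ∨ t (k + 1) ≤ 0)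
    (ha : ContinuousOn a (Icc (t 0) (t M))) (ha₁ : ContinuousOn a₁ (Icc (t 0) (t M)))
    (hu₂ : ContinuousOn u₂ (Icc (t 0) (t M))) (hu₃ : ContinuousOn u₃ (Icc (t 0) (t M))) :
    PiecewiseContinuous t M (compensatorDeriv H α δ a a₁ u₂ u₃) := by
  have ps : PiecewiseContinuous t M (fun y => (SignType.sign y : ℝ)) := by
    intro k hk
    rcases hsign k hk with h0 | h0
    · refine ⟨fun _ => 1, continuousOn_const, fun y hy => ?_⟩
      simp [h0.trans_lt hy.1]
    · refine ⟨fun _ => -1, continuousOn_const, fun y hy => ?_⟩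
      simp [hy.2.trans_le h0]
  have pa := PiecewiseContinuous.of_continuousOn ht ha
  have pa₁ := PiecewiseContinuous.of_continuousOn ht ha₁
  have pu₂ := PiecewiseContinuous.of_continuousOn ht hu₂
  have pu₃ := PiecewiseContinuous.of_continuousOn ht hu₃
  have pW : ∀ e : ℝ, PiecewiseContinuous t M fun y => (δ + |y|) ^ e := fun e =>
    PiecewiseContinuous.of_continuousOn ht (continuous_weight_rpow hδ e).continuousOn
  exact ((((ps.const_mul (2 - 2 * α)).mul (pW _)).mul (pa.mul pu₂)).add
    ((pW _).mul ((pa₁.mul pu₂).add (pa.mul pu₃)))).const_mul (H ^ 2 / 12)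

lemma abs_compensatorDeriv_le {lam Cu La : ℝ} (hδ : 0 < δ) (hδ1 : δ ≤ 1) (hlam : lam ≤ 2)
    (hα0 : 0 < α) (hα4 : α ≤ 1 / 4) (hαl : α ≤ lam / 2) (hCu : 0 ≤ Cu) (hLa : 0 ≤ La) {y : ℝ}
    (hy : y ∈ Icc (-1 : ℝ) 1) (hay : |a y| ≤ La * |y|) (ha₁ : |a₁ y| ≤ La)
    (hb₂ : |u₂ y| ≤ Cu * (1 + (δ + |y|) ^ (lam - 2)))
    (hb₃ : |u₃ y| ≤ Cu * (1 + (δ + |y|) ^ (lam - 3))) :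
    |compensatorDeriv H α δ a a₁ u₂ u₃ y| ≤ 6 * H ^ 2 * La * Cu := by
  have hW : 0 < δ + |y| := by positivity
  have hW2 : δ + |y| ≤ 2 := IsLayerMesh.weight_le_two hδ1 hy
  have w2 := rpow_mul_abs_le (j := 2) hW hW2 hCu hαl hα0.le hlam (by linarith) (by norm_num) hb₂
  have w3 := rpow_mul_abs_le (j := 3) hW hW2 hCu hαl hα0.le hlam (by linarith) le_rfl hb₃
  have e2 : (δ + |y|) ^ (2 - 2 * α) = (δ + |y|) ^ (1 - 2 * α) * (δ + |y|) := by
    rw [← Real.rpow_add_one hW.ne']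
    ring_nf
  have e3 : (δ + |y|) ^ (3 - 2 * α) = (δ + |y|) ^ (2 - 2 * α) * (δ + |y|) := by
    rw [← Real.rpow_add_one hW.ne']
    ring_nf
  have haW : |a y| ≤ La * (δ + |y|) :=
    hay.trans (mul_le_mul_of_nonneg_left (by linarith) hLa)
  have p1 := Real.rpow_nonneg hW.le (1 - 2 * α)
  have p2 := Real.rpow_nonneg hW.le (2 - 2 * α)
  have hsgn : |(SignType.sign y : ℝ)| ≤ 1 := by
    rcases lt_trichotomy y 0 with h | h | h <;> simp [h]
  have t1 : |(2 - 2 * α) * (SignType.sign y : ℝ) * (δ + |y|) ^ (1 - 2 * α) * (a y * u₂ y)|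
      ≤ 32 * La * Cu := by
    rw [abs_mul, abs_mul, abs_mul, abs_mul, abs_of_nonneg p1,
      abs_of_nonneg (by linarith : 0 ≤ 2 - 2 * α)]
    calc _ ≤ 2 * 1 * (δ + |y|) ^ (1 - 2 * α) * (La * (δ + |y|) * |u₂ y|) := by
          gcongr
          linarith
      _ = 2 * La * ((δ + |y|) ^ (2 - 2 * α) * |u₂ y|) := by rw [e2]; ring
      _ ≤ 2 * La * (16 * Cu) := mul_le_mul_of_nonneg_left w2 (by positivity)
      _ = _ := by ring
  have t2 : |(δ + |y|) ^ (2 - 2 * α) * (a₁ y * u₂ y)| ≤ 16 * La * Cu := by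
    rw [abs_mul, abs_mul, abs_of_nonneg p2]
    calc _ ≤ (δ + |y|) ^ (2 - 2 * α) * (La * |u₂ y|) := by gcongr
      _ = La * ((δ + |y|) ^ (2 - 2 * α) * |u₂ y|) := by ring
      _ ≤ La * (16 * Cu) := mul_le_mul_of_nonneg_left w2 hLa
      _ = _ := by ring
  have t3 : |(δ + |y|) ^ (2 - 2 * α) * (a y * u₃ y)| ≤ 16 * La * Cu := by
    rw [abs_mul, abs_mul, abs_of_nonneg p2]
    calc _ ≤ (δ + |y|) ^ (2 - 2 * α) * (La * (δ + |y|) * |u₃ y|) := by gcongr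
      _ = La * ((δ + |y|) ^ (3 - 2 * α) * |u₃ y|) := by rw [e3]; ring
      _ ≤ La * (16 * Cu) := mul_le_mul_of_nonneg_left w3 hLa
      _ = _ := by ring
  rw [compensatorDeriv, abs_mul, abs_of_nonneg (by positivity : 0 ≤ H ^ 2 / 12), mul_add]
  have hsum := abs_add_three
    ((2 - 2 * α) * (SignType.sign y : ℝ) * (δ + |y|) ^ (1 - 2 * α) * (a y * u₂ y))
    ((δ + |y|) ^ (2 - 2 * α) * (a₁ y * u₂ y)) ((δ + |y|) ^ (2 - 2 * α) * (a y * u₃ y))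
  rw [add_assoc] at hsum
  have hpos : 0 ≤ La * Cu := mul_nonneg hLa hCu
  calc _ ≤ H ^ 2 / 12 * (64 * (La * Cu)) :=
        mul_le_mul_of_nonneg_left (by linarith) (by positivity)
    _ = 64 / 12 * (H ^ 2 * (La * Cu)) := by ring
    _ ≤ 6 * (H ^ 2 * (La * Cu)) := mul_le_mul_of_nonneg_right (by norm_num) (by positivity)
    _ = _ := by ring

end Compensator

namespace IsLayerMesh

variable {t : ℕ → ℝ} {M : ℕ} {α δ κ H r lam Cu La E : ℝ} {u u₁ u₂ u₃ uI a a₁ : ℝ → ℝ}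

/-- Consistency of the compensated convection term on one element. -/
lemma abs_integral_compensated_le (h : IsLayerMesh t M α δ κ H r) (hδ : 0 < δ) (hδ1 : δ ≤ 1)
    (hκ : 1 ≤ κ) (hlam : lam ≤ 2) (hα0 : 0 < α) (hα4 : α ≤ 1 / 4)
    (hαl : α ≤ lam / 2) (hCu : 0 ≤ Cu) (hLa : 0 ≤ La)
    (ha : ContinuousOn a (Icc (-1) 1)) (ha0 : a 0 = 0)
    (hda : ∀ y ∈ Ioo (-1 : ℝ) 1, HasDerivAt a (a₁ y) y)
    (hLa₁ : ∀ y ∈ Icc (-1 : ℝ) 1, |a₁ y| ≤ La)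
    (hu : ContinuousOn u (Icc (-1) 1)) (hu₂ : ContinuousOn u₂ (Icc (-1) 1))
    (hd : ∀ y ∈ Ioo (-1 : ℝ) 1, HasDerivAt u (u₁ y) y)
    (hd₁ : ∀ y ∈ Ioo (-1 : ℝ) 1, HasDerivAt u₁ (u₂ y) y)
    (hd₂ : ∀ y ∈ Ioo (-1 : ℝ) 1, HasDerivAt u₂ (u₃ y) y)
    (hb₂ : ∀ y ∈ Icc (-1 : ℝ) 1, |u₂ y| ≤ Cu * (1 + (δ + |y|) ^ (lam - 2)))
    (hb₃ : ∀ y ∈ Icc (-1 : ℝ) 1, |u₃ y| ≤ Cu * (1 + (δ + |y|) ^ (lam - 3)))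
    {k : ℕ} (hk : k < M) {s : ℝ}
    (hs : ∀ y ∈ Icc (t k) (t (k + 1)), uI y = uI (t k) + s * (y - t k))
    (hp : uI (t k) = u (t k)) (hq : uI (t (k + 1)) = u (t (k + 1)))
    (hE : ∀ y ∈ Icc (t k) (t (k + 1)), |u y - uI y| ≤ E * r ^ 2) :
    |∫ y in t k..t (k + 1), (a y * (u y - uI y) + compensator H α δ a u₂ y)|
      ≤ (La * E + 16 * (2 / α) ^ 2 * κ ^ 3 * La * Cu + 6 * (2 / α) ^ 2 * La * Cu) * r ^ 2
        * (t (k + 1) - t k) ^ 2 := by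
  have hlt := h.lt k hk
  have hh : 0 < t (k + 1) - t k := sub_pos.mpr hlt
  have hI := h.Icc_subset hk
  have hO := h.Ioo_subset hk
  have hpos : ∀ x : ℝ, 0 < δ + |x| := fun x => by positivity
  have hay : ∀ y ∈ Icc (-1 : ℝ) 1, |a y| ≤ La * |y| := fun y hy => by
    simpa [ha0] using abs_sub_le_of_abs_deriv_le ha hda
      (fun y hy => hLa₁ y (Ioo_subset_Icc_self hy)) hy (by norm_num : (0 : ℝ) ∈ Icc (-1 : ℝ) 1)
  have hGc : ContinuousOn (compensator H α δ a u₂) (Icc (-1) 1) :=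
    continuousOn_compensator hδ ha hu₂
  have hD : ∀ y ∈ Icc (t k) (t (k + 1)), ∀ z ∈ Icc (t k) (t (k + 1)),
      |compensator H α δ a u₂ y - compensator H α δ a u₂ z|
        ≤ 6 * (2 / α) ^ 2 * La * Cu * r ^ 2 * |y - z| := by
    intro y hy z hz
    refine abs_sub_le_of_abs_deriv_le (hGc.mono hI) (fun x hx => hasDerivAt_compensator hδ
      (h.ne_zero hk hx) (hda x (hO hx)) (hd₂ x (hO hx))) (fun x hx => ?_) hy hz
    have hx' := hI (Ioo_subset_Icc_self hx)
    calc _ ≤ 6 * H ^ 2 * La * Cu := abs_compensatorDeriv_le hδ hδ1 hlam hα0 hα4 hαl hCu hLa hx'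
          (hay x hx') (hLa₁ x hx') (hb₂ x hx') (hb₃ x hx')
      _ ≤ 6 * ((2 / α) ^ 2 * r ^ 2) * La * Cu := by
          gcongr
          exact h.width_sq_le
      _ = _ := by ring
  have hD0 : 0 ≤ 6 * (2 / α) ^ 2 * La * Cu * r ^ 2 := by positivity
  rcases h.comparable k hk with hcomp | ⟨hzero, -⟩
  · obtain ⟨m, hm, hwidth⟩ := h.width k hk
    have hsq := sq_width_eq hδ hwidth
    have key := abs_integral_element_le (A := La) (E := E * r ^ 2)
      (E₃ := 16 * (2 / α) ^ 2 * κ ^ 3 * La * Cu * r ^ 2)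
      (D := 6 * (2 / α) ^ 2 * La * Cu * r ^ 2) hlt hm (ha.mono hI) (hGc.mono hI)
      (hu.mono hI) (hu₂.mono hI) (fun y hy => hd y (hO hy)) (fun y hy => hd₁ y (hO hy))
      (fun y hy => hd₂ y (hO hy)) hs hp hq
      (fun y hy => abs_sub_le_of_abs_deriv_le ha hda
        (fun y hy => hLa₁ y (Ioo_subset_Icc_self hy)) (hI hy) (hI hm)) hE
      (fun z hz => ?_) (fun y hy => hD y hy m hm)
      (by rw [hsq, compensator]; ring) hLa hD0
    · calc _ ≤ _ := key
        _ = _ := by ring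
    · have hz' := Ioo_subset_Icc_self hz
      have i1 := rpow_sub_mul_le_of_le_mul (j := 3) (hpos m) (hpos z) hκ
        (hcomp m hm z hz') hα0.le (by linarith)
      have i2 := rpow_mul_abs_le (j := 3) (hpos z) (weight_le_two hδ1 (hI hz')) hCu hαl hα0.le
        hlam (by linarith) le_rfl (hb₃ z (hI hz'))
      have e3 : (δ + |m|) ^ (3 - 2 * α) = (δ + |m|) ^ (2 - 2 * α) * (δ + |m|) := by
        rw [← Real.rpow_add_one (hpos m).ne']
        ring_nf
      rw [Real.rpow_ofNat] at i1
      rw [hsq, abs_mul]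
      have haW : |a m| ≤ La * (δ + |m|) :=
        (hay m (hI hm)).trans (mul_le_mul_of_nonneg_left (by linarith) hLa)
      have hp2 := Real.rpow_nonneg (hpos m).le (2 - 2 * α)
      calc |a m| * |u₃ z| * (H ^ 2 * (δ + |m|) ^ (2 - 2 * α))
          ≤ La * (δ + |m|) * |u₃ z| * ((2 / α) ^ 2 * r ^ 2 * (δ + |m|) ^ (2 - 2 * α)) := by
            gcongr
            exact h.width_sq_le
        _ = La * (2 / α) ^ 2 * r ^ 2 * |u₃ z| * (δ + |m|) ^ (3 - 2 * α) := by rw [e3]; ring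
        _ ≤ La * (2 / α) ^ 2 * r ^ 2 * |u₃ z| * (κ ^ 3 * (δ + |z|) ^ (3 - 2 * α)) :=
            mul_le_mul_of_nonneg_left i1 (by positivity)
        _ = La * (2 / α) ^ 2 * r ^ 2 * κ ^ 3 * ((δ + |z|) ^ (3 - 2 * α) * |u₃ z|) := by ring
        _ ≤ La * (2 / α) ^ 2 * r ^ 2 * κ ^ 3 * (16 * Cu) :=
            mul_le_mul_of_nonneg_left i2 (by positivity)
        _ = _ := by ring
  · obtain ⟨z, hz, hz0⟩ : ∃ z ∈ Icc (t k) (t (k + 1)), z = 0 := by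
      rcases hzero with h0 | h0
      · exact ⟨_, left_mem_Icc.mpr hlt.le, h0⟩
      · exact ⟨_, right_mem_Icc.mpr hlt.le, h0⟩
    subst hz0
    have hb := intervalIntegral.norm_integral_le_of_norm_le_const (a := t k) (b := t (k + 1))
      (C := (La * E + 6 * (2 / α) ^ 2 * La * Cu) * r ^ 2 * (t (k + 1) - t k))
      (f := fun y => a y * (u y - uI y) + compensator H α δ a u₂ y) (fun y hy => by
        rw [uIoc_of_le hlt.le] at hy
        have hy' : y ∈ Icc (t k) (t (k + 1)) := Ioc_subset_Icc_self hy
        have h5 : |y| ≤ t (k + 1) - t k := by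
          rw [abs_le]
          constructor <;> linarith [hy'.1, hy'.2, hz.1, hz.2]
        have i1 : |a y * (u y - uI y)| ≤ La * (t (k + 1) - t k) * (E * r ^ 2) := by
          rw [abs_mul]
          exact mul_le_mul ((hay y (hI hy')).trans (mul_le_mul_of_nonneg_left h5 hLa)) (hE y hy')
            (abs_nonneg _) (by positivity)
        have i2 : |compensator H α δ a u₂ y|
            ≤ 6 * (2 / α) ^ 2 * La * Cu * r ^ 2 * (t (k + 1) - t k) := by
          have h6 := hD y hy' 0 hz
          have h7 : compensator H α δ a u₂ 0 = 0 := by simp [compensator, ha0]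
          rw [h7, sub_zero, sub_zero] at h6
          exact h6.trans (mul_le_mul_of_nonneg_left h5 hD0)
        rw [Real.norm_eq_abs]
        calc _ ≤ _ := abs_add_le _ _
          _ ≤ _ := add_le_add i1 i2
          _ = _ := by ring)
    rw [Real.norm_eq_abs, abs_of_pos hh] at hb
    have hpos' : 0 ≤ 16 * (2 / α) ^ 2 * κ ^ 3 * La * Cu * r ^ 2 * (t (k + 1) - t k) ^ 2 := by
      positivity
    calc _ ≤ _ := hb
      _ ≤ (La * E + 6 * (2 / α) ^ 2 * La * Cu) * r ^ 2 * (t (k + 1) - t k) *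
          (t (k + 1) - t k) + 16 * (2 / α) ^ 2 * κ ^ 3 * La * Cu * r ^ 2 *
            (t (k + 1) - t k) ^ 2 := le_add_of_nonneg_right hpos'
      _ = _ := by ring

/-- The squared `L²` error of a Galerkin solution on a layer mesh is of order `r ^ 4`. -/
lemma integral_error_sq_le (h : IsLayerMesh t M α δ κ H r) (hδ : 0 < δ) (hδ1 : δ ≤ 1)
    (hκ : 1 ≤ κ) (hlam0 : 0 < lam) (hlam : lam ≤ 2) (hα0 : 0 < α) (hα4 : α ≤ 1 / 4)
    (hαl : α ≤ lam / 2) (hCu : 0 ≤ Cu) (hLa : 0 ≤ La)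
    {ε γ Lc : ℝ} (hε : 0 ≤ ε) (hγ : 0 < γ) {c f uN : ℝ → ℝ} {sN : ℕ → ℝ}
    (ha : ContinuousOn a (Icc (-1) 1)) (ha₁ : ContinuousOn a₁ (Icc (-1) 1)) (ha0 : a 0 = 0)
    (hda : ∀ y ∈ Ioo (-1 : ℝ) 1, HasDerivAt a (a₁ y) y)
    (hLa₁ : ∀ y ∈ Icc (-1 : ℝ) 1, |a₁ y| ≤ La)
    (hc : ContinuousOn c (Icc (-1) 1)) (hLc : ∀ y ∈ Icc (-1 : ℝ) 1, |c y| ≤ Lc)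
    (hf : ContinuousOn f (Icc (-1) 1))
    (hu : ContinuousOn u (Icc (-1) 1)) (hu₁ : ContinuousOn u₁ (Icc (-1) 1))
    (hu₂ : ContinuousOn u₂ (Icc (-1) 1)) (hu₃ : ContinuousOn u₃ (Icc (-1) 1))
    (hd : ∀ y ∈ Ioo (-1 : ℝ) 1, HasDerivAt u (u₁ y) y)
    (hd₁ : ∀ y ∈ Ioo (-1 : ℝ) 1, HasDerivAt u₁ (u₂ y) y)
    (hd₂ : ∀ y ∈ Ioo (-1 : ℝ) 1, HasDerivAt u₂ (u₃ y) y)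
    (hb₁ : ∀ y ∈ Icc (-1 : ℝ) 1, |u₁ y| ≤ Cu * (1 + (δ + |y|) ^ (lam - 1)))
    (hb₂ : ∀ y ∈ Icc (-1 : ℝ) 1, |u₂ y| ≤ Cu * (1 + (δ + |y|) ^ (lam - 2)))
    (hb₃ : ∀ y ∈ Icc (-1 : ℝ) 1, |u₃ y| ≤ Cu * (1 + (δ + |y|) ^ (lam - 3)))
    (hode : ∀ y ∈ Ioo (-1 : ℝ) 1, -ε * u₂ y + a y * u₁ y + c y * u y = f y)
    (hcoer : ∀ y ∈ Ioo (-1 : ℝ) 1, γ ≤ c y - a₁ y / 2)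
    (hu0 : u (-1) = 0) (hu1 : u 1 = 0)
    (huN : ContinuousOn uN (Icc (-1) 1)) (huN0 : uN (-1) = 0) (huN1 : uN 1 = 0)
    (hsN : ∀ k < M, ∀ y ∈ Icc (t k) (t (k + 1)), uN y = uN (t k) + sN k * (y - t k))
    (hgal : ∀ v : ℝ → ℝ, ContinuousOn v (Icc (-1) 1) → v (-1) = 0 → v 1 = 0 →
      (∀ k < M, ∃ s : ℝ, ∀ y ∈ Icc (t k) (t (k + 1)), v y = v (t k) + s * (y - t k)) →
      Beps ε a c uN v = ∫ y in (-1 : ℝ)..1, f y * v y)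
    {E D S : ℝ}
    (hE : E = 16 * (2 / α) ^ 2 * κ ^ 2 * Cu + 256 * Cu * (1 + 1 / lam))
    (hD : D = 6 * (2 / α) ^ 2 * La * Cu)
    (hS : S = (La * E + D + Lc * E)
      + 6 * (La * E + 16 * (2 / α) ^ 2 * κ ^ 3 * La * Cu + D)) :
    ∫ y in (-1 : ℝ)..1, (u y - uN y) ^ 2 ≤ (4 * E ^ 2 + 4 * S ^ 2 / γ ^ 2) * (r ^ 2) ^ 2 := by
  obtain ⟨uI, huIc, huI⟩ := exists_piecewise_linear_interpolant h.lt u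
  have hM : 0 < M := by
    rcases Nat.eq_zero_or_pos M with h0 | h0
    · have h1 := h.left
      have h2 := h.right
      rw [h0, h1] at h2
      norm_num at h2
    · exact h0
  have hnode : ∀ k ≤ M, uI (t k) = u (t k) := by
    intro k hk
    rcases hk.lt_or_eq with hk' | rfl
    · rw [huI k hk' _ (left_mem_Icc.mpr (h.lt k hk').le)]
      simp
    · obtain ⟨n, rfl⟩ : ∃ n, k = n + 1 := ⟨k - 1, by omega⟩
      have hlt := h.lt n n.lt_succ_self
      rw [huI n n.lt_succ_self _ (right_mem_Icc.mpr hlt.le),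
        div_mul_cancel₀ _ (sub_pos.mpr hlt).ne']
      ring
  have hsI : ∀ k < M, ∀ y ∈ Icc (t k) (t (k + 1)), uI y = uI (t k) +
      (u (t (k + 1)) - u (t k)) / (t (k + 1) - t k) * (y - t k) := fun k hk y hy => by
    rw [hnode k hk.le, huI k hk y hy]
  have hI0 : uI (-1) = 0 := by rw [← h.left, hnode 0 (Nat.zero_le M), h.left, hu0]
  have hI1 : uI 1 = 0 := by rw [← h.right, hnode M le_rfl, h.right, hu1]
  have hE0 : 0 ≤ E := by rw [hE]; positivity
  have hηk : ∀ k < M, ∀ y ∈ Icc (t k) (t (k + 1)), |u y - uI y| ≤ E * r ^ 2 :=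
    fun k hk y hy => hE ▸ h.abs_interpolation_error_le hδ hδ1 hκ hlam0 hlam hα0 hα4 hαl hCu hu
      hd hd₁ hb₁ hb₂ hk (hsI k hk) (hnode k hk.le) (hnode (k + 1) hk) hy
  have hG := hgal (fun z => uN z - uI z) (huN.sub huIc.continuousOn) (by simp [huN0, hI0])
    (by simp [huN1, hI1]) (fun k hk => ⟨sN k - (u (t (k + 1)) - u (t k)) / (t (k + 1) - t k),
      fun y hy => by
        rw [hsN k hk y hy, hsI k hk y hy]
        ring⟩)
  have hay : ∀ y ∈ Icc (-1 : ℝ) 1, |a y| ≤ La * |y| := fun y hy => by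
    simpa [ha0] using abs_sub_le_of_abs_deriv_le ha hda
      (fun y hy => hLa₁ y (Ioo_subset_Icc_self hy)) hy (by norm_num : (0 : ℝ) ∈ Icc (-1 : ℝ) 1)
  have hstab := discrete_error_le (t := t) (M := M) (a := a) (a₁ := a₁) (c := c) (f := f) (u := u)
    (u₁ := u₁) (u₂ := u₂) (G := compensator H α δ a u₂)
    (G₁ := compensatorDeriv H α δ a a₁ u₂ u₃) (uN := uN) (uI := uI) (sN := sN)
    (sI := fun k => (u (t (k + 1)) - u (t k)) / (t (k + 1) - t k)) (ε := ε) (γ := γ)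
    (J := (La * E + 16 * (2 / α) ^ 2 * κ ^ 3 * La * Cu + D) * r ^ 2)
    (K := (La * E + D + Lc * E) * r ^ 2) h.lt hε
  have hPC := piecewiseContinuous_compensatorDeriv (H := H) (α := α) (a := a) (a₁ := a₁)
    (u₂ := u₂) (u₃ := u₃) hδ h.lt h.sign
  simp only [h.left, h.right] at hstab hPC
  have hw := hstab ha ha₁ hda hc hf hu hu₁ hu₂ hd hd₁ hode (continuousOn_compensator hδ ha hu₂)
    (hPC ha ha₁ hu₂ hu₃)
    (fun k hk y hy => hasDerivAt_compensator hδ (h.ne_zero hk hy) (hda y (h.Ioo_subset hk hy))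
      (hd₂ y (h.Ioo_subset hk hy)))
    huN huIc.continuousOn hsN hsI hnode (by rw [huN0, hI0]) (by rw [huN1, hI1]) hcoer hG
    (fun k hk y hy => by
      have hy' := Ioo_subset_Icc_self hy
      have hy1 := h.Icc_subset hk hy'
      have hη := hηk k hk y hy'
      have i1 : |a₁ y * (u y - uI y)| ≤ La * (E * r ^ 2) := by
        rw [abs_mul]
        exact mul_le_mul (hLa₁ y hy1) hη (abs_nonneg _) hLa
      have i2 : |c y * (u y - uI y)| ≤ Lc * (E * r ^ 2) := by
        rw [abs_mul]
        exact mul_le_mul (hLc y hy1) hη (abs_nonneg _) ((abs_nonneg _).trans (hLc y hy1))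
      have i3 : |compensatorDeriv H α δ a a₁ u₂ u₃ y| ≤ D * r ^ 2 := by
        calc _ ≤ 6 * H ^ 2 * La * Cu := abs_compensatorDeriv_le hδ hδ1 hlam hα0 hα4 hαl hCu hLa
              hy1 (hay y hy1) (hLa₁ y hy1) (hb₂ y hy1) (hb₃ y hy1)
          _ ≤ 6 * ((2 / α) ^ 2 * r ^ 2) * La * Cu := by
              gcongr
              exact h.width_sq_le
          _ = _ := by rw [hD]; ring
      calc _ ≤ |a₁ y * (u y - uI y) + compensatorDeriv H α δ a a₁ u₂ u₃ y|
            + |c y * (u y - uI y)| := abs_sub _ _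
        _ ≤ |a₁ y * (u y - uI y)| + |compensatorDeriv H α δ a a₁ u₂ u₃ y|
            + |c y * (u y - uI y)| := by gcongr; exact abs_add_le _ _
        _ ≤ _ := by linarith)
    (fun k hk => hD ▸ h.abs_integral_compensated_le hδ hδ1 hκ hlam hα0 hα4 hαl hCu hLa ha ha0
      hda hLa₁ hu hu₂ hd hd₁ hd₂ hb₂ hb₃ hk (hsI k hk) (hnode k hk.le) (hnode (k + 1) hk)
      (hηk k hk))
  have hwc : ContinuousOn (fun y => uN y - uI y) (Icc (-1) 1) := huN.sub huIc.continuousOn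
  have hw2 := integral_sq_le_of_le_integral_abs (by norm_num : (-1 : ℝ) ≤ 1) hγ hwc hw
  have hη : ∀ y ∈ Icc (-1 : ℝ) 1, |u y - uI y| ≤ E * r ^ 2 := by
    intro y hy
    by_cases hyt : y ∈ t '' Iic M
    · obtain ⟨k, hk, rfl⟩ := hyt
      rw [hnode k hk, sub_self, abs_zero]
      positivity
    · have hne : ∀ k ≤ M, y ≠ t k := fun k hk he => hyt ⟨k, hk, he.symm⟩
      have hy0 := hne 0 (Nat.zero_le M)
      have hyM := hne M le_rfl
      rw [h.left] at hy0
      rw [h.right] at hyM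
      obtain ⟨k, hk, hyk⟩ := exists_mem_mesh_Ioo (t := t) (M := M) (y := y) (by
        rw [h.left, h.right]
        exact ⟨lt_of_le_of_ne hy.1 hy0.symm, lt_of_le_of_ne hy.2 hyM⟩) hyt
      exact hηk k hk y (Ioo_subset_Icc_self hyk)
  have i2 : IntervalIntegrable (fun y => (uN y - uI y) ^ 2) volume (-1) 1 :=
    (hwc.pow 2).intervalIntegrable_of_Icc (by norm_num)
  have i1 : IntervalIntegrable (fun y => (u y - uN y) ^ 2) volume (-1) 1 :=
    ((hu.sub huN).pow 2).intervalIntegrable_of_Icc (by norm_num)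
  have hm := integral_mono_on (by norm_num : (-1 : ℝ) ≤ 1) i1
    ((intervalIntegrable_const (c := 2 * (E * r ^ 2) ^ 2)).add (i2.const_mul 2)) (fun y hy => by
      have h1 : (u y - uI y) ^ 2 ≤ (E * r ^ 2) ^ 2 := by
        rw [← sq_abs]
        exact pow_le_pow_left₀ (abs_nonneg _) (hη y hy) 2
      nlinarith [sq_nonneg ((u y - uI y) + (uN y - uI y))])
  rw [intervalIntegral.integral_add intervalIntegrable_const (i2.const_mul 2),
    intervalIntegral.integral_const, smul_eq_mul, intervalIntegral.integral_const_mul] at hm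
  calc _ ≤ _ := hm
    _ ≤ (1 - -1) * (2 * (E * r ^ 2) ^ 2) + 2 * ((1 - -1) * ((La * E + D + Lc * E) * r ^ 2
        + 6 * ((La * E + 16 * (2 / α) ^ 2 * κ ^ 3 * La * Cu + D) * r ^ 2)) ^ 2 / γ ^ 2) := by
      linarith
    _ = _ := by
      rw [hS]
      ring

end IsLayerMesh

/-- The properties of a single mesh interval `[x, y]` required by `IsLayerMesh`. -/
structure IsLayerElement (α δ κ H r x y : ℝ) : Prop where
  lt : x < y
  sign : 0 ≤ x ∨ y ≤ 0
  width : ∃ m ∈ Icc x y, y - x = H * (δ + |m|) ^ (1 - α)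
  comparable : (∀ v ∈ Icc x y, ∀ z ∈ Icc x y, δ + |v| ≤ κ * (δ + |z|)) ∨
    ((x = 0 ∨ y = 0) ∧ ∀ v ∈ Icc x y, (δ + |v|) ^ α ≤ 4 * r)

lemma IsLayerElement.neg {α δ κ H r x y : ℝ} (h : IsLayerElement α δ κ H r x y) :
    IsLayerElement α δ κ H r (-y) (-x) where
  lt := neg_lt_neg h.lt
  sign := h.sign.symm.imp neg_nonneg.mpr neg_nonpos.mpr
  width := by
    obtain ⟨m, hm, he⟩ := h.width
    exact ⟨-m, ⟨neg_le_neg hm.2, neg_le_neg hm.1⟩, by rw [abs_neg, ← he]; ring⟩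
  comparable := by
    have hmem : ∀ v ∈ Icc (-y) (-x), -v ∈ Icc x y := fun v hv =>
      ⟨le_neg_of_le_neg hv.2, neg_le_of_neg_le hv.1⟩
    rcases h.comparable with hc | ⟨h0, hc⟩
    · exact Or.inl fun v hv z hz => by simpa using hc _ (hmem v hv) _ (hmem z hz)
    · exact Or.inr ⟨h0.symm.imp neg_eq_zero.mpr neg_eq_zero.mpr,
        fun v hv => by simpa using hc _ (hmem v hv)⟩

lemma exists_rpow_sub_rpow_eq {α p q : ℝ} (hα : 0 < α) (hp : 0 < p) (hpq : p < q) :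
    ∃ m ∈ Icc (p ^ (1 / α)) (q ^ (1 / α)),
      q ^ (1 / α) - p ^ (1 / α) = (q - p) / α * m ^ (1 - α) := by
  have hd : ∀ x : ℝ, 0 < x → HasDerivAt (fun x : ℝ => x ^ (1 / α)) (1 / α * x ^ (1 / α - 1)) x :=
    fun x hx => Real.hasDerivAt_rpow_const (Or.inl hx.ne')
  obtain ⟨ξ, hξ, he⟩ := exists_hasDerivAt_eq_slope (fun x : ℝ => x ^ (1 / α))
    (fun x => 1 / α * x ^ (1 / α - 1)) hpq
    (fun x hx => (hd x (hp.trans_le hx.1)).continuousAt.continuousWithinAt)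
    (fun x hx => hd x (hp.trans hx.1))
  have hξ0 : 0 < ξ := hp.trans hξ.1
  refine ⟨ξ ^ (1 / α), ⟨by have := hξ.1; gcongr, by have := hξ.2; gcongr⟩, ?_⟩
  rw [eq_div_iff (sub_pos.mpr hpq).ne'] at he
  rw [← Real.rpow_mul hξ0.le, ← he, show 1 / α * (1 - α) = 1 / α - 1 by field_simp]
  ring

/-- The image under `s ↦ s ^ (1 / α) - δ` of an interval `[p, q]` to the right of `δ ^ α`. -/
lemma isLayerElement_rpow {α δ r p q : ℝ} (hα : 0 < α) (hδ : 0 < δ) (hp : δ ^ α ≤ p)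
    (hpq : p < q) (hc : q ≤ 2 * p ∨ p = δ ^ α ∧ q ≤ 4 * r) :
    IsLayerElement α δ (2 ^ (1 / α)) ((q - p) / α) r (p ^ (1 / α) - δ) (q ^ (1 / α) - δ) := by
  have hδα : 0 < δ ^ α := by positivity
  have hp0 : 0 < p := hδα.trans_le hp
  have hq0 : 0 < q := hp0.trans hpq
  have hroot : (δ ^ α) ^ (1 / α) = δ := by
    rw [← Real.rpow_mul hδ.le, mul_one_div_cancel hα.ne', Real.rpow_one]
  have hx : 0 ≤ p ^ (1 / α) - δ := by
    rw [sub_nonneg]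
    nth_rw 1 [← hroot]
    gcongr
  have habs : ∀ v ∈ Icc (p ^ (1 / α) - δ) (q ^ (1 / α) - δ),
      p ^ (1 / α) ≤ δ + |v| ∧ δ + |v| ≤ q ^ (1 / α) := fun v hv => by
    rw [abs_of_nonneg (hx.trans hv.1)]
    exact ⟨by linarith [hv.1], by linarith [hv.2]⟩
  refine ⟨?_, Or.inl hx, ?_, ?_⟩
  · gcongr
  · obtain ⟨m, hm, he⟩ := exists_rpow_sub_rpow_eq hα hp0 hpq
    refine ⟨m - δ, ⟨by linarith [hm.1], by linarith [hm.2]⟩, ?_⟩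
    rw [abs_of_nonneg (by linarith [hm.1]), add_sub_cancel, ← he]
    ring
  · rcases hc with hc | ⟨he, hq⟩
    · refine Or.inl fun v hv z hz => (habs v hv).2.trans ?_
      calc q ^ (1 / α) ≤ (2 * p) ^ (1 / α) := by gcongr
        _ = 2 ^ (1 / α) * p ^ (1 / α) := Real.mul_rpow zero_le_two hp0.le
        _ ≤ _ := by
          gcongr
          exact (habs z hz).1
    · refine Or.inr ⟨Or.inl (by rw [he, hroot, sub_self]), fun v hv => ?_⟩
      calc (δ + |v|) ^ α ≤ (q ^ (1 / α)) ^ α := by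
            gcongr
            exact (habs v hv).2
        _ = q := by
          rw [← Real.rpow_mul hq0.le, one_div_mul_cancel hα.ne', Real.rpow_one]
        _ ≤ 4 * r := hq

lemma rpow_half_rpow {ε : ℝ} (hε : 0 < ε) (α : ℝ) :
    (ε ^ ((1 : ℝ) / 2)) ^ α = ε ^ (α / 2) := by
  rw [← Real.rpow_mul hε.le]
  congr 1
  ring

lemma liseikinX_natCast (α ε : ℝ) (N j : ℕ) :
    liseikinX α ε N (j : ℤ) = (ε ^ (α / 2) + (j : ℝ) / N *
      ((1 + ε ^ ((1 : ℝ) / 2)) ^ α - ε ^ (α / 2))) ^ (1 / α) - ε ^ ((1 : ℝ) / 2) := by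
  rw [liseikinX, liseikinPhi, if_pos (by positivity), Int.cast_natCast]

lemma liseikinX_zero {α ε : ℝ} (hα : 0 < α) (hε : 0 < ε) (N : ℕ) :
    liseikinX α ε N 0 = 0 := by
  have h := liseikinX_natCast α ε N 0
  rw [Nat.cast_zero, Nat.cast_zero, zero_div, zero_mul, add_zero, ← Real.rpow_mul hε.le,
    show α / 2 * (1 / α) = 1 / 2 by field_simp, sub_self] at h
  exact h

lemma liseikinX_neg_natCast {α ε : ℝ} (hα : 0 < α) (hε : 0 < ε) {N : ℕ} (hN : 0 < N) (j : ℕ) :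
    liseikinX α ε N (-(j : ℤ)) = -liseikinX α ε N j := by
  rcases j.eq_zero_or_pos with rfl | hj
  · simp [liseikinX_zero hα hε]
  · have hneg : ¬ (0 : ℝ) ≤ ((-(j : ℤ) : ℤ) : ℝ) / N := by
      rw [not_le]
      exact div_neg_of_neg_of_pos (by simpa using hj) (by exact_mod_cast hN)
    rw [liseikinX_natCast, liseikinX, liseikinPhi, if_neg hneg]
    simp [neg_div]

lemma isLayerElement_liseikinX {α ε D : ℝ} {N : ℕ} (hα0 : 0 < α) (hε : 0 < ε)
    (hD : D = (1 + ε ^ ((1 : ℝ) / 2)) ^ α - ε ^ (α / 2)) (hD0 : 0 < D) (hD2 : D ≤ 2)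
    (hN : 0 < N) (j : ℕ) :
    IsLayerElement α (ε ^ ((1 : ℝ) / 2)) (2 ^ (1 / α)) (D / α / N) (1 / N)
      (liseikinX α ε N (j : ℤ)) (liseikinX α ε N ((j : ℤ) + 1)) := by
  have hN' : (0 : ℝ) < N := by exact_mod_cast hN
  have hA : 0 < ε ^ (α / 2) := by positivity
  have hr : D / N ≤ 2 * (1 / N) := by
    rw [mul_one_div]
    gcongr
  have hDN : 0 < D / N := by positivity
  have hstep : ε ^ (α / 2) + ((j + 1 : ℕ) : ℝ) / N * D - (ε ^ (α / 2) + (j : ℝ) / N * D)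
      = D / N := by
    push_cast
    ring
  have h := isLayerElement_rpow (r := 1 / N) (p := ε ^ (α / 2) + (j : ℝ) / N * D)
    (q := ε ^ (α / 2) + ((j + 1 : ℕ) : ℝ) / N * D) hα0
    (Real.rpow_pos_of_pos hε ((1 : ℝ) / 2)) (by
      rw [rpow_half_rpow hε]
      exact le_add_of_nonneg_right (by positivity)) (by linarith) (by
      rcases j.eq_zero_or_pos with rfl | hj
      · rcases le_total (D / N) (ε ^ (α / 2)) with hle | hle
        · left
          simp only [Nat.cast_zero, zero_div, zero_mul, add_zero] at hstep ⊢
          linarith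
        · right
          rw [rpow_half_rpow hε]
          simp only [Nat.cast_zero, zero_div, zero_mul, add_zero] at hstep ⊢
          exact ⟨trivial, by linarith⟩
      · left
        have h1 : D / N ≤ (j : ℝ) / N * D := by
          have : (1 : ℝ) ≤ j := by exact_mod_cast hj
          rw [div_mul_eq_mul_div]
          gcongr
          nlinarith
        linarith)
  rw [hstep] at h
  have e := liseikinX_natCast α ε N (j + 1)
  rw [Nat.cast_succ (R := ℤ)] at e
  rw [liseikinX_natCast, e, ← hD, div_right_comm]
  exact h

lemma isLayerMesh_liseikinX {α ε : ℝ} {N : ℕ} (hα0 : 0 < α) (hα1 : α ≤ 1) (hε : 0 < ε)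
    (hε1 : ε ≤ 1) (hN : 0 < N) :
    IsLayerMesh (fun k : ℕ => liseikinX α ε N ((k : ℤ) - N)) (2 * N) α (ε ^ ((1 : ℝ) / 2))
      (2 ^ (1 / α)) (((1 + ε ^ ((1 : ℝ) / 2)) ^ α - ε ^ (α / 2)) / α / N) (1 / N) := by
  have hN' : (0 : ℝ) < N := by exact_mod_cast hN
  have hδ : 0 < ε ^ ((1 : ℝ) / 2) := by positivity
  have hδ1 : ε ^ ((1 : ℝ) / 2) ≤ 1 := Real.rpow_le_one hε.le hε1 (by norm_num)
  have hA : 0 < ε ^ (α / 2) := by positivity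
  obtain ⟨D, hD⟩ : ∃ D, D = (1 + ε ^ ((1 : ℝ) / 2)) ^ α - ε ^ (α / 2) := ⟨_, rfl⟩
  have hD0 : 0 < D := by
    rw [hD, sub_pos, ← rpow_half_rpow hε]
    exact Real.rpow_lt_rpow hδ.le (by linarith) hα0
  have hD2 : D ≤ 2 := by
    have : (1 + ε ^ ((1 : ℝ) / 2)) ^ α ≤ (1 + ε ^ ((1 : ℝ) / 2)) ^ (1 : ℝ) :=
      Real.rpow_le_rpow_of_exponent_le (by linarith) hα1
    rw [Real.rpow_one] at this
    linarith
  have hlast : liseikinX α ε N (N : ℤ) = 1 := by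
    rw [liseikinX_natCast, div_self hN'.ne', one_mul, add_sub_cancel,
      ← Real.rpow_mul (by linarith), mul_one_div_cancel hα0.ne', Real.rpow_one]
    ring
  have helem : ∀ k < 2 * N, IsLayerElement α (ε ^ ((1 : ℝ) / 2)) (2 ^ (1 / α)) (D / α / N) (1 / N)
      (liseikinX α ε N ((k : ℤ) - N)) (liseikinX α ε N (((k + 1 : ℕ) : ℤ) - N)) := by
    intro k hk
    rcases le_or_gt N k with hNk | hNk
    · obtain ⟨j, rfl⟩ := Nat.exists_eq_add_of_le hNk
      convert isLayerElement_liseikinX hα0 hε hD hD0 hD2 hN j using 2 <;> push_cast <;> ring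
    · obtain ⟨j, rfl⟩ := Nat.exists_eq_add_of_lt hNk
      have h := (isLayerElement_liseikinX hα0 hε hD hD0 hD2 hN j).neg
      rw [← liseikinX_neg_natCast hα0 hε hN, ← Nat.cast_succ,
        ← liseikinX_neg_natCast hα0 hε hN] at h
      convert h using 2 <;> push_cast <;> ring
  rw [← hD]
  exact {
    left := by
      simp only [Nat.cast_zero, zero_sub]
      rw [liseikinX_neg_natCast hα0 hε hN, hlast]
    right := by
      simp only [show ((2 * N : ℕ) : ℤ) - N = N by push_cast; ring]
      exact hlast
    lt := fun k hk => (helem k hk).lt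
    sign := fun k hk => (helem k hk).sign
    width := fun k hk => (helem k hk).width
    width_pos := by positivity
    width_le := by
      rw [mul_one_div]
      gcongr
    comparable := fun k hk => (helem k hk).comparable }

lemma hasDerivAt_iteratedDerivWithin {p q : ℝ} {n : WithTop ℕ∞} {g : ℝ → ℝ}
    (hg : ContDiffOn ℝ n g (Icc p q)) {i : ℕ} (hi : (i : WithTop ℕ∞) < n) {y : ℝ}
    (hy : y ∈ Ioo p q) :
    HasDerivAt (iteratedDerivWithin i g (Icc p q))
      (iteratedDerivWithin (i + 1) g (Icc p q) y) y := by
  have hpq : p < q := hy.1.trans hy.2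
  rw [iteratedDerivWithin_succ]
  exact (hg.differentiableOn_iteratedDerivWithin hi (uniqueDiffOn_Icc hpq) y
    (Ioo_subset_Icc_self hy)).hasDerivWithinAt.hasDerivAt (Icc_mem_nhds hy.1 hy.2)

lemma exists_abs_le_of_continuousOn_Icc {p q : ℝ} {g : ℝ → ℝ} (hg : ContinuousOn g (Icc p q)) :
    ∃ L, 0 ≤ L ∧ ∀ y ∈ Icc p q, |g y| ≤ L := by
  obtain ⟨L, hL⟩ := isCompact_Icc.exists_bound_of_continuousOn hg
  exact ⟨max L 0, le_max_right _ _, fun y hy => (hL y hy).trans (le_max_left _ _)⟩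

lemma liseikinX_memVN1 {α ε : ℝ} {N : ℕ} {v : ℝ → ℝ} (h : MemVN1 (liseikinX α ε N) N v)
    {k : ℕ} (hk : k < 2 * N) : ∃ s : ℝ,
      ∀ y ∈ Icc (liseikinX α ε N ((k : ℤ) - N)) (liseikinX α ε N (((k + 1 : ℕ) : ℤ) - N)),
        v y = v (liseikinX α ε N ((k : ℤ) - N)) + s * (y - liseikinX α ε N ((k : ℤ) - N)) := by
  have he : ((k + 1 : ℕ) : ℤ) - N - 1 = (k : ℤ) - N := by push_cast; ring
  have := h.2.2.2 (((k + 1 : ℕ) : ℤ) - N) (by omega) (by omega)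
  rw [he] at this
  exact ⟨_, this⟩

lemma memVN1_liseikinX {α ε : ℝ} {N : ℕ} {v : ℝ → ℝ}
    (hlt : ∀ k < 2 * N, liseikinX α ε N ((k : ℤ) - N) < liseikinX α ε N (((k + 1 : ℕ) : ℤ) - N))
    (hv : ContinuousOn v (Icc (-1) 1)) (hv0 : v (-1) = 0) (hv1 : v 1 = 0)
    (h : ∀ k < 2 * N, ∃ s : ℝ,
      ∀ y ∈ Icc (liseikinX α ε N ((k : ℤ) - N)) (liseikinX α ε N (((k + 1 : ℕ) : ℤ) - N)),
        v y = v (liseikinX α ε N ((k : ℤ) - N)) + s * (y - liseikinX α ε N ((k : ℤ) - N))) :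
    MemVN1 (liseikinX α ε N) N v := by
  refine ⟨hv, hv0, hv1, fun i hi hiN y hy => ?_⟩
  obtain ⟨k, hk⟩ : ∃ k : ℕ, (k : ℤ) = i - 1 + N := ⟨(i - 1 + N).toNat, by omega⟩
  have e₁ : (k : ℤ) - N = i - 1 := by omega
  have e₂ : ((k + 1 : ℕ) : ℤ) - N = i := by omega
  have hk2 : k < 2 * N := by omega
  have hlt := hlt k hk2
  obtain ⟨s, hs⟩ := h k hk2
  rw [e₁, e₂] at hlt hs
  rw [hs y hy, hs _ (right_mem_Icc.mpr hlt.le), add_sub_cancel_left,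
    mul_div_cancel_right₀ _ (sub_pos.mpr hlt).ne']

end Liseikin

theorem l2_error_liseikin (lam α Cu γ : ℝ)
    (hlam0 : 0 < lam) (hlam1 : lam < 2) (hCu : 0 < Cu) (hγ : 0 < γ)
    (hα0 : 0 < α) (hα : α ≤ min (lam / 2) (1/4))
    (a c f : ℝ → ℝ)
    (ha : ContDiffOn ℝ 1 a (Set.Icc (-1) 1)) (hc : ContDiffOn ℝ 1 c (Set.Icc (-1) 1))
    (hf : ContDiffOn ℝ 1 f (Set.Icc (-1) 1)) (ha0 : a 0 = 0)
    (hcoer : ∀ y ∈ Set.Icc (-1:ℝ) 1, γ ≤ c y - derivWithin a (Set.Icc (-1) 1) y / 2) :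
    ∃ C : ℝ, 0 < C ∧
      ∀ ε : ℝ, 0 < ε → ε ≤ 1 → ∀ N : ℕ, 1 ≤ N →
      ∀ u uN : ℝ → ℝ,
        ContDiffOn ℝ 3 u (Set.Icc (-1) 1) → u (-1) = 0 → u 1 = 0 →
        (∀ y ∈ Set.Ioo (-1:ℝ) 1,
          -ε * iteratedDerivWithin 2 u (Set.Icc (-1) 1) y
            + a y * derivWithin u (Set.Icc (-1) 1) y + c y * u y = f y) →
        (∀ i : ℕ, i ≤ 3 → ∀ y ∈ Set.Icc (-1:ℝ) 1,
          |iteratedDerivWithin i u (Set.Icc (-1) 1) y|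
            ≤ Cu * (1 + (ε ^ ((1:ℝ)/2) + |y|) ^ (lam - i))) →
        MemVN1 (liseikinX α ε N) N uN →
        (∀ v, MemVN1 (liseikinX α ε N) N v →
          Beps ε a c uN v = ∫ y in (-1:ℝ)..1, f y * v y) →
        Real.sqrt (∫ y in (-1:ℝ)..1, (u y - uN y)^2) ≤ C / (N:ℝ) ^ 2 := by
  have hαl : α ≤ lam / 2 := hα.trans (min_le_left _ _)
  have hα4 : α ≤ 1 / 4 := hα.trans (min_le_right _ _)
  have hI : UniqueDiffOn ℝ (Set.Icc (-1 : ℝ) 1) := uniqueDiffOn_Icc (by norm_num)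
  have ha₁ : ContinuousOn (derivWithin a (Set.Icc (-1) 1)) (Set.Icc (-1) 1) :=
    ha.continuousOn_derivWithin hI le_rfl
  obtain ⟨La, hLa, hLa₁⟩ := exists_abs_le_of_continuousOn_Icc ha₁
  obtain ⟨Lc, -, hLc⟩ := exists_abs_le_of_continuousOn_Icc hc.continuousOn
  have hda : ∀ y ∈ Set.Ioo (-1 : ℝ) 1, HasDerivAt a (derivWithin a (Set.Icc (-1) 1) y) y :=
    fun y hy => by
      simpa [iteratedDerivWithin_one] using
        hasDerivAt_iteratedDerivWithin ha (i := 0) (by norm_num) hy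
  obtain ⟨E, hE⟩ : ∃ E, E = 16 * (2 / α) ^ 2 * (2 ^ (1 / α)) ^ 2 * Cu
    + 256 * Cu * (1 + 1 / lam) := ⟨_, rfl⟩
  obtain ⟨D, hD⟩ : ∃ D, D = 6 * (2 / α) ^ 2 * La * Cu := ⟨_, rfl⟩
  obtain ⟨S, hS⟩ : ∃ S, S = (La * E + D + Lc * E)
    + 6 * (La * E + 16 * (2 / α) ^ 2 * (2 ^ (1 / α)) ^ 3 * La * Cu + D) := ⟨_, rfl⟩
  have hE0 : 0 < E := by rw [hE]; positivity
  refine ⟨Real.sqrt (4 * E ^ 2 + 4 * S ^ 2 / γ ^ 2), by positivity, ?_⟩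
  intro ε hε hε1 N hN u uN hu hu0 hu1 hode hb huN hgal
  have hmesh := isLayerMesh_liseikinX (N := N) hα0 (by linarith) hε hε1 hN
  choose! sN hsN using fun (k : ℕ) (hk : k < 2 * N) => liseikinX_memVN1 huN hk
  have hcd : ∀ i : ℕ, i ≤ 3 →
      ContinuousOn (iteratedDerivWithin i u (Set.Icc (-1) 1)) (Set.Icc (-1) 1) := fun i hi =>
    hu.continuousOn_iteratedDerivWithin (by exact_mod_cast hi) hI
  have hd : ∀ i : ℕ, i < 3 → ∀ y ∈ Set.Ioo (-1 : ℝ) 1,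
      HasDerivAt (iteratedDerivWithin i u (Set.Icc (-1) 1))
        (iteratedDerivWithin (i + 1) u (Set.Icc (-1) 1) y) y := fun i hi y hy =>
    hasDerivAt_iteratedDerivWithin hu (by exact_mod_cast hi) hy
  have key := hmesh.integral_error_sq_le (u := u) (uN := uN) (a := a) (c := c) (f := f)
    (a₁ := derivWithin a (Set.Icc (-1) 1)) (lam := lam) (Cu := Cu) (La := La) (Lc := Lc)
    (ε := ε) (γ := γ) (sN := sN)
    (u₁ := iteratedDerivWithin 1 u (Set.Icc (-1) 1))
    (u₂ := iteratedDerivWithin 2 u (Set.Icc (-1) 1))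
    (u₃ := iteratedDerivWithin 3 u (Set.Icc (-1) 1))
    (by positivity) (Real.rpow_le_one hε.le hε1 (by norm_num))
    (Real.one_le_rpow one_le_two (by positivity)) hlam0 hlam1.le hα0 hα4 hαl hCu.le hLa hε.le hγ
    ha.continuousOn ha₁ ha0 hda hLa₁ hc.continuousOn hLc hf.continuousOn hu.continuousOn
    (hcd 1 (by norm_num)) (hcd 2 (by norm_num)) (hcd 3 le_rfl)
    (by simpa using hd 0 (by norm_num)) (hd 1 (by norm_num)) (hd 2 (by norm_num))
    (by simpa using hb 1 (by norm_num)) (by simpa using hb 2 (by norm_num))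
    (by simpa using hb 3 le_rfl)
    (by simpa only [iteratedDerivWithin_one] using hode)
    (fun y hy => hcoer y (Set.Ioo_subset_Icc_self hy)) hu0 hu1 huN.1 huN.2.1 huN.2.2.1 hsN
    (fun v hv hv0 hv1 hvs => hgal v (memVN1_liseikinX hmesh.lt hv hv0 hv1 hvs)) hE hD hS
  calc _ ≤ Real.sqrt ((4 * E ^ 2 + 4 * S ^ 2 / γ ^ 2) * ((1 / (N : ℝ)) ^ 2) ^ 2) :=
        Real.sqrt_le_sqrt key
    _ = _ := by
      rw [Real.sqrt_mul (by positivity), Real.sqrt_sq (by positivity)]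
      ring
end

section
/- For all real numbers α, c with 0 < α ≤ 1 and 0 < c ≤ 1, one has 0 < (1+c)^α − c^α ≤ ((2^α − 1)/ln 2) · ( ln(1+c) − ln(c) ). Moreover, for 0 < α ≤ 1 one has α ln 2 ≤ 2^α − 1 ≤ α. -/
/-- Secant slopes of the exponential are monotone in both endpoints: the secant over `[x, y]`
with `x ≤ 0 < y ≤ z` is no steeper than the one over `[0, z]`. -/
theorem Real.exp_sub_exp_le_secant_mul {x y z : ℝ} (hx : x ≤ 0) (hy : 0 < y) (hyz : y ≤ z) :
    Real.exp y - Real.exp x ≤ (Real.exp z - 1) / z * (y - x) := by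
  have h₁ := convexOn_exp.secant_mono (Set.mem_univ y) (Set.mem_univ x) (Set.mem_univ 0)
    (by linarith : x < y).ne hy.ne hx
  have h₂ := convexOn_exp.secant_mono (Set.mem_univ 0) (Set.mem_univ y) (Set.mem_univ z)
    hy.ne' (by linarith : 0 < z).ne' hyz
  rw [← neg_div_neg_eq, ← neg_div_neg_eq (Real.exp 0 - Real.exp y)] at h₁
  simp only [neg_sub, sub_zero, Real.exp_zero] at h₁ h₂
  exact (div_le_iff₀ (by linarith)).1 (h₁.trans h₂)

theorem one_plus_c_pow_sub_log (α c : ℝ) (hα0 : 0 < α) (hα1 : α ≤ 1) (hc0 : 0 < c) (hc1 : c ≤ 1) :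
    (0 < (1 + c) ^ α - c ^ α ∧
      (1 + c) ^ α - c ^ α ≤ ((2:ℝ) ^ α - 1) / Real.log 2 * (Real.log (1 + c) - Real.log c)) ∧
    (α * Real.log 2 ≤ (2:ℝ) ^ α - 1 ∧ (2:ℝ) ^ α - 1 ≤ α) := by
  have h2 : 0 < Real.log 2 := Real.log_pos one_lt_two
  refine ⟨⟨sub_pos.2 (Real.rpow_lt_rpow hc0.le (by linarith) hα0), ?_⟩, ?_, ?_⟩
  · have h := Real.exp_sub_exp_le_secant_mul (x := Real.log c * α) (y := Real.log (1 + c) * α)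
      (z := Real.log 2 * α)
      (mul_nonpos_of_nonpos_of_nonneg (Real.log_nonpos hc0.le hc1) hα0.le)
      (mul_pos (Real.log_pos (by linarith)) hα0)
      (mul_le_mul_of_nonneg_right (Real.log_le_log (by linarith) (by linarith)) hα0.le)
    rw [← Real.rpow_def_of_pos (by linarith), ← Real.rpow_def_of_pos hc0,
      ← Real.rpow_def_of_pos two_pos] at h
    refine h.trans_eq ?_
    field_simp
  · have h := Real.add_one_le_exp (Real.log 2 * α)
    rw [← Real.rpow_def_of_pos two_pos] at h
    linarith
  · have h := rpow_one_add_le_one_add_mul_self (s := 1) (by norm_num) hα0.le hα1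
    norm_num at h
    linarith
end
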